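/- arXiv:2006.02621 — 4 statements merged into one kernel-verified Lean document; each statement's English description precedes it below -/
import Mathlib

section
/- Let ρ̂ : W → PSL(2,ℝ) = SL(2,ℝ)/{±I} be a group homomorphism such that ρ̂(P), ρ̂(Q), ρ̂(R) are all nontrivial, and let u ∈ F₂ be palindromic. Then ρ̂(ι(u)) is either trivial or hyperbolic; that is, every lift M ∈ SL(2,ℝ) of ρ̂(ι(u)) satisfies M = ±I or |tr M| > 2. -/
/-- `SL(2,ℝ)`. -/
abbrev SL2R := Matrix.SpecialLinearGroup (Fin 2) ℝ

/-- The free group `F₂` on two generators. -/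
abbrev F2 := FreeGroup Bool

/-- The generator `X` of `F₂`. -/
def Xg : F2 := FreeGroup.of true

/-- The generator `Y` of `F₂`. -/
def Yg : F2 := FreeGroup.of false

/-- For `z > 2`, the unique real `ζ ≥ 1` with `ζ + ζ⁻¹ = z` (junk value `1` otherwise). -/
noncomputable def zetaOf (z : ℝ) : ℝ :=
  if 2 < z then (z + Real.sqrt (z ^ 2 - 4)) / 2 else 1

lemma zetaOf_ne_zero (z : ℝ) : zetaOf z ≠ 0 := by
  unfold zetaOf
  split_ifs with h
  · have h4 : (0:ℝ) ≤ Real.sqrt (z ^ 2 - 4) := Real.sqrt_nonneg _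
    have : 0 < (z + Real.sqrt (z ^ 2 - 4)) / 2 := by nlinarith
    exact ne_of_gt this
  · norm_num

/-- The normal-form matrix `A_ξ = [[x,−1],[1,0]]` as an element of `SL(2,ℝ)`. -/
noncomputable def Amat (x : ℝ) : SL2R :=
  ⟨!![x, -1; 1, 0], by simp [Matrix.det_fin_two_of]⟩

/-- The normal-form matrix `B_ξ = [[0,ζ⁻¹],[−ζ,y]]` as an element of `SL(2,ℝ)`. -/
noncomputable def Bmat (y z : ℝ) : SL2R :=
  ⟨!![0, (zetaOf z)⁻¹; -(zetaOf z), y], by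
    simp [Matrix.det_fin_two_of]
    exact inv_mul_cancel₀ (zetaOf_ne_zero z)⟩

/-- Evaluation of words: the homomorphism `F₂ → SL(2,ℝ)` sending `X ↦ A`, `Y ↦ B`. -/
noncomputable def ev (A B : SL2R) : F2 →* SL2R :=
  FreeGroup.lift (fun b => if b then A else B)

/-- The (lifted) holonomy representation of `ξ = (x,y,z)`: `w ↦ w(A_ξ, B_ξ)`. -/
noncomputable def rho (ξ : ℝ × ℝ × ℝ) : F2 →* SL2R :=
  ev (Amat ξ.1) (Bmat ξ.2.1 ξ.2.2)

/-- The Fricke–Klein space `𝔠_θ`. -/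
def FK (θ : ℝ) : Set (ℝ × ℝ × ℝ) :=
  {p | 2 < p.1 ∧ 2 < p.2.1 ∧ 2 < p.2.2 ∧
    p.1 ^ 2 + p.2.1 ^ 2 + p.2.2 ^ 2 - p.1 * p.2.1 * p.2.2 - 2 = -2 * Real.cos (θ / 2)}

/-- The full Fricke–Klein space `𝔠`. -/
def FKall : Set (ℝ × ℝ × ℝ) :=
  {p | 2 < p.1 ∧ 2 < p.2.1 ∧ 2 < p.2.2 ∧
    -2 < p.1 ^ 2 + p.2.1 ^ 2 + p.2.2 ^ 2 - p.1 * p.2.1 * p.2.2 - 2 ∧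
    p.1 ^ 2 + p.2.1 ^ 2 + p.2.2 ^ 2 - p.1 * p.2.1 * p.2.2 - 2 < 2}

/-- Trace of an element of `SL(2,ℝ)`. -/
noncomputable def trSL (A : SL2R) : ℝ := Matrix.trace (A : Matrix (Fin 2) (Fin 2) ℝ)
/-- Relators of the free Coxeter group `W = ℤ₂ * ℤ₂ * ℤ₂`. -/
def coxRels : Set (FreeGroup (Fin 3)) :=
  {FreeGroup.of 0 ^ 2, FreeGroup.of 1 ^ 2, FreeGroup.of 2 ^ 2}

/-- The free Coxeter group `W = ⟨P, Q, R ∣ P² = Q² = R² = 1⟩`. -/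
abbrev W := PresentedGroup coxRels

/-- The generator `P` of `W`. -/
def Pg : W := PresentedGroup.of 0

/-- The generator `Q` of `W`. -/
def Qg : W := PresentedGroup.of 1

/-- The generator `R` of `W`. -/
def Rg : W := PresentedGroup.of 2

/-- The embedding `ι : F₂ → W`, `X ↦ QR`, `Y ↦ RP`. -/
def iota : F2 →* W := FreeGroup.lift (fun b => if b then Qg * Rg else Rg * Pg)

/-- The automorphism of `F₂` inverting `X` and `Y`. -/
def sigXY : F2 →* F2 := FreeGroup.lift (fun b => (FreeGroup.of b)⁻¹)

/-- The endomorphism of `F₂` inverting `Y` and `Z = (XY)⁻¹`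
(it sends `X ↦ Y⁻¹X⁻¹Y` and `Y ↦ Y⁻¹`, hence `Z ↦ Z⁻¹`). -/
def sigYZ : F2 →* F2 := FreeGroup.lift (fun b => if b then Yg⁻¹ * Xg⁻¹ * Yg else Yg⁻¹)

/-- The endomorphism of `F₂` inverting `Z = (XY)⁻¹` and `X`
(it sends `X ↦ X⁻¹` and `Y ↦ XY⁻¹X⁻¹`, hence `Z ↦ Z⁻¹`). -/
def sigZX : F2 →* F2 := FreeGroup.lift (fun b => if b then Xg⁻¹ else Xg * Yg⁻¹ * Xg⁻¹)

/-- A word `u ∈ F₂` is palindromic if one of the three inversions sends it to `u⁻¹`. -/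
def Palindromic (u : F2) : Prop := sigXY u = u⁻¹ ∨ sigYZ u = u⁻¹ ∨ sigZX u = u⁻¹

/-- The lift of `iota` to the free group on `P`, `Q`, `R`. -/
def iotaLift : F2 →* FreeGroup (Fin 3) :=
  FreeGroup.lift (fun b => if b then FreeGroup.of 1 * FreeGroup.of 2
    else FreeGroup.of 2 * FreeGroup.of 0)

lemma mk_iotaLift (u : F2) : PresentedGroup.mk coxRels (iotaLift u) = iota u := by
  have h : (PresentedGroup.mk coxRels).comp iotaLift = iota := by
    ext b
    cases b <;> simp [iotaLift, iota, Pg, Qg, Rg, PresentedGroup.of]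
  exact DFunLike.congr_fun h u

lemma gen_mul_self (k : Fin 3) :
    (PresentedGroup.of k : W) * PresentedGroup.of k = 1 := by
  have h : (PresentedGroup.mk coxRels) (FreeGroup.of k ^ 2) = 1 :=
    PresentedGroup.one_of_mem (by fin_cases k <;> simp [coxRels])
  simpa [PresentedGroup.of, sq] using h

lemma gen_inv (k : Fin 3) : (PresentedGroup.of k : W)⁻¹ = PresentedGroup.of k :=
  inv_eq_of_mul_eq_one_left (gen_mul_self k)

/-- Each of the three inversions of `F₂` is conjugation by a generator of `W`. -/
lemma Palindromic.exists_conj_eq_inv {u : F2} (hu : Palindromic u) :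
    ∃ k : Fin 3, (PresentedGroup.of k : W) * iota u * PresentedGroup.of k = (iota u)⁻¹ := by
  have key : ∀ (k : Fin 3) (σ : F2 →* F2),
      iota.comp σ = (MulAut.conj (PresentedGroup.of k : W)).toMonoidHom.comp iota →
      σ u = u⁻¹ →
      (PresentedGroup.of k : W) * iota u * PresentedGroup.of k = (iota u)⁻¹ := by
    intro k σ h hσ
    have h' := DFunLike.congr_fun h u
    simp only [MonoidHom.comp_apply, hσ, map_inv, MulEquiv.toMonoidHom_eq_coe,
      MonoidHom.coe_coe, MulAut.conj_apply, gen_inv] at h'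
    exact h'.symm
  have hc : ∀ (k : Fin 3) (g : W),
      (PresentedGroup.of k : W) * (PresentedGroup.of k * g) = g := fun k g => by
    rw [← mul_assoc, gen_mul_self, one_mul]
  rcases hu with h | h | h
  · refine ⟨2, key 2 _ ?_ h⟩
    ext b
    cases b <;> simp [iota, sigXY, Pg, Qg, Rg, gen_inv, gen_mul_self, hc, mul_assoc]
  · refine ⟨0, key 0 _ ?_ h⟩
    ext b
    cases b <;> simp [iota, sigYZ, Xg, Yg, Pg, Qg, Rg, gen_inv, gen_mul_self, hc, mul_assoc]
  · refine ⟨1, key 1 _ ?_ h⟩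
    ext b
    cases b <;> simp [iota, sigZX, Xg, Yg, Pg, Qg, Rg, gen_inv, hc, mul_assoc]

lemma SL2R.mem_center_iff {A : SL2R} : A ∈ Subgroup.center SL2R ↔ A = 1 ∨ A = -1 := by
  constructor
  · intro h
    obtain ⟨r, hr, hA⟩ := Matrix.SpecialLinearGroup.mem_center_iff.1 h
    rw [Fintype.card_fin, sq, mul_self_eq_one_iff] at hr
    rcases hr with rfl | rfl
    · left; ext i j; simp [← hA]
    · right; ext i j; fin_cases i <;> fin_cases j <;> simp [← hA]
  · rintro (rfl | rfl)
    · exact one_mem _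
    · exact Subgroup.mem_center_iff.2 fun g => by simp

/-- A lift to `SL(2,ℝ)` of an element of order two of `PSL(2,ℝ)` squares to `-1`. -/
lemma SL2R.sq_eq_neg_one_of_mk {A : SL2R}
    (h1 : (QuotientGroup.mk A : SL2R ⧸ Subgroup.center SL2R) ≠ 1)
    (h2 : (QuotientGroup.mk A : SL2R ⧸ Subgroup.center SL2R) ^ 2 = 1) : A ^ 2 = -1 := by
  rw [← QuotientGroup.mk_pow, QuotientGroup.eq_one_iff, SL2R.mem_center_iff] at h2
  refine h2.resolve_left fun h => h1 ?_
  rw [QuotientGroup.eq_one_iff, SL2R.mem_center_iff]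
  have hinv : A = A⁻¹ := eq_inv_of_mul_eq_one_left (by rw [← sq, h])
  have hd := A.det_coe
  rw [Matrix.det_fin_two] at hd
  have h' := congrArg (fun B : SL2R => (B : Matrix (Fin 2) (Fin 2) ℝ)) hinv
  simp only [Matrix.SpecialLinearGroup.coe_inv, Matrix.adjugate_fin_two] at h'
  have h00 : A 0 0 = A 1 1 := congrFun (congrFun h' 0) 0
  have h01 : A 0 1 = -A 0 1 := congrFun (congrFun h' 0) 1
  have h10 : A 1 0 = -A 1 0 := congrFun (congrFun h' 1) 0
  have e01 : A 0 1 = 0 := by linarith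
  have e10 : A 1 0 = 0 := by linarith
  rw [h00, e01, e10] at hd
  have e11 : A 1 1 = 1 ∨ A 1 1 = -1 := mul_self_eq_one_iff.1 (by linarith)
  rcases e11 with e | e
  · left; ext i j; fin_cases i <;> fin_cases j <;> simp [h00, e01, e10, e]
  · right; ext i j; fin_cases i <;> fin_cases j <;> simp [h00, e01, e10, e]

/-- A square root of `-1` in `SL(2,ℝ)` has trace zero. -/
lemma SL2R.apply_one_one_of_sq_eq_neg_one {A : SL2R} (h : A ^ 2 = -1) : A 1 1 = -A 0 0 := by
  have hinv : A = -A⁻¹ := by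
    rw [eq_comm, neg_eq_iff_eq_neg, inv_eq_iff_mul_eq_one, mul_neg, ← sq, h, neg_neg]
  have h' := congrArg (fun B : SL2R => (B : Matrix (Fin 2) (Fin 2) ℝ)) hinv
  simp only [Matrix.SpecialLinearGroup.coe_neg, Matrix.SpecialLinearGroup.coe_inv,
    Matrix.adjugate_fin_two] at h'
  have h00 : A 0 0 = -A 1 1 := congrFun (congrFun h' 0) 0
  linarith

/-- The product of two half-turns of the hyperbolic plane is trivial or hyperbolic. -/
lemma SL2R.mul_trivial_or_hyperbolic {A B : SL2R} (hA : A ^ 2 = -1) (hB : B ^ 2 = -1) :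
    A * B = 1 ∨ A * B = -1 ∨ 2 < |trSL (A * B)| := by
  have hA1 := SL2R.apply_one_one_of_sq_eq_neg_one hA
  have hB1 := SL2R.apply_one_one_of_sq_eq_neg_one hB
  have hdA := A.det_coe
  have hdB := B.det_coe
  rw [Matrix.det_fin_two, hA1] at hdA
  rw [Matrix.det_fin_two, hB1] at hdB
  have htr : trSL (A * B) = 2 * A 0 0 * B 0 0 + A 0 1 * B 1 0 + A 1 0 * B 0 1 := by
    simp only [trSL, Matrix.SpecialLinearGroup.coe_mul, Matrix.trace_fin_two,
      Matrix.mul_apply, Fin.sum_univ_two, hA1, hB1]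
    ring
  by_cases hAB : A = B
  · right; left; rw [hAB, ← sq, hB]
  by_cases hAB' : A = -B
  · left; rw [hAB', neg_mul, ← sq, hB, neg_neg]
  right; right
  rw [htr]
  generalize hc : A 1 0 = c at *
  generalize hf : B 1 0 = f at *
  generalize ha : A 0 0 = a at *
  generalize hb : A 0 1 = b at *
  generalize hd : B 0 0 = d at *
  generalize he : B 0 1 = e at *
  have hb0 : b ≠ 0 := by rintro rfl; nlinarith [sq_nonneg a]
  have he0 : e ≠ 0 := by rintro rfl; nlinarith [sq_nonneg d]
  have hmul : b * e * (2 * a * d + b * f + c * e) = -(b ^ 2 + e ^ 2 + (b * d - a * e) ^ 2) := by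
    linear_combination -e ^ 2 * hdA - b ^ 2 * hdB
  have hbe : 0 < |b * e| := abs_pos.2 (mul_ne_zero hb0 he0)
  have hmul' := congrArg abs hmul
  rw [abs_mul, abs_neg, abs_of_nonneg (a := b ^ 2 + _ + _) (by positivity)] at hmul'
  by_contra! hle
  have hle' : b ^ 2 + e ^ 2 + (b * d - a * e) ^ 2 ≤ 2 * |b * e| := by
    nlinarith
  rcases abs_cases (b * e) with ⟨h, -⟩ | ⟨h, -⟩ <;> rw [h] at hle'
  · have h1 : b = e := by
      have : (b - e) ^ 2 = 0 := by nlinarith [sq_nonneg (b - e), sq_nonneg (b * d - a * e)]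
      exact sub_eq_zero.1 (pow_eq_zero_iff two_ne_zero |>.1 this)
    subst h1
    have h2 : b * (d - a) = 0 := by
      have : (b * d - a * b) ^ 2 = 0 := by nlinarith [sq_nonneg (b * d - a * b)]
      linear_combination pow_eq_zero_iff two_ne_zero |>.1 this
    have h3 : d = a := sub_eq_zero.1 ((mul_eq_zero.1 h2).resolve_left hb0)
    subst h3
    have h4 : c = f := mul_left_cancel₀ hb0 (by linarith)
    refine hAB ?_
    ext i j; fin_cases i <;> fin_cases j <;> simp [ha, hb, hc, hd, he, hf, hA1, hB1, h4]
  · have h1 : b = -e := by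
      have : (b + e) ^ 2 = 0 := by nlinarith [sq_nonneg (b + e), sq_nonneg (b * d - a * e)]
      exact eq_neg_of_add_eq_zero_left (pow_eq_zero_iff two_ne_zero |>.1 this)
    subst h1
    have h2 : e * (d + a) = 0 := by
      have : (-e * d - a * e) ^ 2 = 0 := by nlinarith [sq_nonneg (-e * d - a * e)]
      linear_combination -(pow_eq_zero_iff two_ne_zero |>.1 this)
    have h3 : a = -d :=
      eq_neg_of_add_eq_zero_right ((mul_eq_zero.1 h2).resolve_left he0)
    subst h3
    have h4 : c = -f := mul_left_cancel₀ he0 (by linarith)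
    refine hAB' ?_
    ext i j; fin_cases i <;> fin_cases j <;> simp [ha, hb, hc, hd, he, hf, hA1, hB1, h4]

/-- Words of odd length in square roots of `-1` square to `-1` as soon as they represent an
involution of the free Coxeter group. The length is tracked modulo `4`. -/
lemma lift_sq_eq_neg_one {p : Fin 3 → SL2R} (hp : ∀ i, p i ^ 2 = -1) {s : FreeGroup (Fin 3)}
    (hs : PresentedGroup.mk coxRels (s ^ 2) = 1)
    (hodd : FreeGroup.lift (fun _ : Fin 3 => Multiplicative.ofAdd (1 : ZMod 4)) s ^ 2 =
      Multiplicative.ofAdd 2) :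
    FreeGroup.lift p s ^ 2 = -1 := by
  set χ := FreeGroup.lift (fun _ : Fin 3 => Multiplicative.ofAdd (1 : ZMod 4)) with hχ
  let z : SL2R × Multiplicative (ZMod 4) := (-1, Multiplicative.ofAdd 2)
  let φ := (FreeGroup.lift p).prod χ
  have hz : z ∈ Subgroup.center (SL2R × Multiplicative (ZMod 4)) :=
    Subgroup.mem_center_iff.2 fun g => Prod.ext (by simp [z]) (mul_comm _ _)
  have hN : (Subgroup.zpowers z).Normal :=
    ⟨fun n hn g => by
      rwa [Subgroup.mem_center_iff.1 (Subgroup.zpowers_le.2 hz hn) g, mul_inv_cancel_right]⟩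
  have hgen : ∀ i, φ (FreeGroup.of i ^ 2) = z := fun i =>
    Prod.ext (by simp [φ, z, hp]) (by simp [φ, z, hχ]; rfl)
  have hle : Subgroup.normalClosure coxRels ≤ (Subgroup.zpowers z).comap φ := by
    refine Subgroup.normalClosure_le_normal ?_
    rintro _ (rfl | rfl | rfl) <;>
      exact (hgen _).symm ▸ Subgroup.mem_zpowers z
  have hmem : φ (s ^ 2) ∈ Subgroup.zpowers z :=
    hle (PresentedGroup.mk_eq_one_iff.1 hs)
  have hz2 : z ^ 2 = 1 := Prod.ext (by simp [z]) (by decide)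
  obtain ⟨n, hn⟩ := Subgroup.mem_zpowers_iff.1 hmem
  rcases Int.even_or_odd' n with ⟨m, rfl | rfl⟩
  · have h1 : φ (s ^ 2) = 1 := by
      rw [← hn, zpow_mul, zpow_ofNat, hz2, one_zpow]
    have h2 : χ s ^ 2 = 1 := by simpa [φ] using congrArg Prod.snd h1
    rw [hodd] at h2
    exact absurd h2 (by decide)
  · have h1 : φ (s ^ 2) = z := by
      rw [← hn, zpow_add, zpow_mul, zpow_ofNat, hz2, one_zpow, one_mul, zpow_one]
    simpa [φ, z] using congrArg Prod.fst h1

lemma length_sq_of_mul_iotaLift (k : Fin 3) (u : F2) :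
    FreeGroup.lift (fun _ : Fin 3 => Multiplicative.ofAdd (1 : ZMod 4))
      (FreeGroup.of k * iotaLift u) ^ 2 = Multiplicative.ofAdd 2 := by
  set χ := FreeGroup.lift (fun _ : Fin 3 => Multiplicative.ofAdd (1 : ZMod 4)) with hχ
  have h : (powMonoidHom 2).comp (χ.comp iotaLift) = 1 := by
    ext b
    cases b <;> simp [hχ, iotaLift] <;> rfl
  have hu : χ (iotaLift u) ^ 2 = 1 := DFunLike.congr_fun h u
  rw [map_mul, mul_pow, hu, mul_one, hχ, FreeGroup.lift_apply_of]
  rfl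

/-- If `ρ̂ : W → PSL(2,ℝ)` has `ρ̂(P), ρ̂(Q), ρ̂(R)` nontrivial and `u ∈ F₂`
is palindromic, then `ρ̂(ι(u))` is trivial or hyperbolic: every lift `M ∈ SL(2,ℝ)` satisfies
`M = ±I` or `|tr M| > 2`. -/
theorem stmt_9 (ρ : W →* SL2R ⧸ Subgroup.center SL2R)
    (hP : ρ Pg ≠ 1) (hQ : ρ Qg ≠ 1) (hR : ρ Rg ≠ 1)
    (u : F2) (hu : Palindromic u) :
    ∀ M : SL2R, QuotientGroup.mk M = ρ (iota u) →
      ((M : Matrix (Fin 2) (Fin 2) ℝ) = 1 ∨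
       (M : Matrix (Fin 2) (Fin 2) ℝ) = -1 ∨
       2 < |trSL M|) := by
  have hρ : ∀ i, ρ (PresentedGroup.of i) ≠ 1 := by
    intro i; fin_cases i
    exacts [hP, hQ, hR]
  choose p hp using fun i => QuotientGroup.mk_surjective (ρ (PresentedGroup.of i))
  have hp2 : ∀ i, p i ^ 2 = -1 := fun i => SL2R.sq_eq_neg_one_of_mk (hp i ▸ hρ i) (by
    rw [hp, ← map_pow, sq, gen_mul_self, map_one])
  have hlift : (QuotientGroup.mk' (Subgroup.center SL2R)).comp (FreeGroup.lift p) =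
      ρ.comp (PresentedGroup.mk coxRels) := by
    ext i
    simpa [PresentedGroup.of] using hp i
  obtain ⟨k, hk⟩ := hu.exists_conj_eq_inv
  have hs : PresentedGroup.mk coxRels ((FreeGroup.of k * iotaLift u) ^ 2) = 1 := by
    rw [map_pow, map_mul, mk_iotaLift, sq, ← mul_assoc]
    exact (congrArg (· * iota u) hk).trans (inv_mul_cancel _)
  have hB := lift_sq_eq_neg_one hp2 hs (length_sq_of_mul_iotaLift k u)
  have hprod : p k * FreeGroup.lift p (FreeGroup.of k * iotaLift u) =
      -FreeGroup.lift p (iotaLift u) := by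
    rw [map_mul, FreeGroup.lift_apply_of, ← mul_assoc, ← sq, hp2, neg_one_mul]
  intro M hM
  have hM' : M = p k * FreeGroup.lift p (FreeGroup.of k * iotaLift u) ∨
      M = -(p k * FreeGroup.lift p (FreeGroup.of k * iotaLift u)) := by
    have hL := DFunLike.congr_fun hlift (iotaLift u)
    simp only [MonoidHom.comp_apply, mk_iotaLift, QuotientGroup.mk'_apply] at hL
    have h := QuotientGroup.eq.1 (hL.trans hM.symm)
    rw [SL2R.mem_center_iff] at h
    rw [hprod, neg_neg]
    rcases h with h | h
    · right; exact (inv_mul_eq_one.1 h).symm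
    · left; rw [inv_mul_eq_iff_eq_mul.1 h, mul_neg_one]
  have hT := SL2R.mul_trivial_or_hyperbolic (hp2 k) hB
  rcases hM' with rfl | rfl
  · exact hT.imp (fun h => by rw [h]; simp) (Or.imp (fun h => by rw [h]; simp) id)
  · rcases hT with h | h | h
    · right; left; rw [h]; simp
    · left; rw [h]; simp
    · right; right
      simpa [trSL, abs_neg] using h
end

section
/- Let A, B ∈ SL(2,ℝ) satisfy A² = −I and B² = −I. Then either AB = I, or AB = −I, or |tr(AB)| > 2. -/
/-- The entries of a real `2 × 2` matrix squaring to `-1`. -/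
lemma entries_of_sq_eq_neg_one {M : Matrix (Fin 2) (Fin 2) ℝ} (h : M ^ 2 = -1) :
    M 1 1 = -M 0 0 ∧ M 0 0 ^ 2 + M 0 1 * M 1 0 = -1 ∧ M 0 1 ≠ 0 := by
  have h00 := congr_fun (congr_fun h 0) 0
  have h01 := congr_fun (congr_fun h 0) 1
  simp [pow_two, Matrix.mul_apply, Fin.sum_univ_two] at h00 h01
  have hb : M 0 1 ≠ 0 := by
    intro hb
    rw [hb] at h00
    nlinarith [mul_self_nonneg (M 0 0)]
  have hd : M 0 1 * (M 1 1 + M 0 0) = 0 := by linarith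
  refine ⟨?_, by linarith, hb⟩
  linarith [(mul_eq_zero.mp hd).resolve_left hb]

/-- Two real trace-free matrices `[[a, b], [c, -a]]` and `[[p, q], [r, -p]]` of determinant one
whose product has trace in `[-2, 2]` agree up to sign. -/
lemma eq_or_eq_neg_of_abs_trace_mul_le {a b c p q r : ℝ}
    (hA : a ^ 2 + b * c = -1) (hB : p ^ 2 + q * r = -1) (hb : b ≠ 0) (hq : q ≠ 0)
    (hT : |2 * a * p + b * r + c * q| ≤ 2) :
    (p = a ∧ q = b ∧ r = c) ∨ (p = -a ∧ q = -b ∧ r = -c) := by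
  have key : b * q * (2 * a * p + b * r + c * q) = -((a * q - b * p) ^ 2 + b ^ 2 + q ^ 2) := by
    linear_combination b ^ 2 * hB + q ^ 2 * hA
  have hle : (a * q - b * p) ^ 2 + b ^ 2 + q ^ 2 ≤ |b| * |q| * 2 := by
    calc (a * q - b * p) ^ 2 + b ^ 2 + q ^ 2
        = |b * q * (2 * a * p + b * r + c * q)| := by
          rw [key, abs_neg, abs_of_nonneg (by positivity)]
      _ = |b| * |q| * |2 * a * p + b * r + c * q| := by rw [abs_mul, abs_mul]
      _ ≤ |b| * |q| * 2 := by gcongr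
  have hsum : (a * q - b * p) ^ 2 + (|b| - |q|) ^ 2 ≤ 0 := by
    nlinarith [sq_abs b, sq_abs q]
  have hdet : a * q - b * p = 0 := by
    apply pow_eq_zero_iff two_ne_zero |>.mp
    nlinarith [sq_nonneg (a * q - b * p), sq_nonneg (|b| - |q|)]
  have habs : |q| = |b| := by
    have : |b| - |q| = 0 := by
      apply pow_eq_zero_iff two_ne_zero |>.mp
      nlinarith [sq_nonneg (a * q - b * p), sq_nonneg (|b| - |q|)]
    linarith
  rcases abs_eq_abs.mp habs with rfl | rfl
  · obtain rfl : p = a := mul_left_cancel₀ hb (by linarith)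
    exact Or.inl ⟨rfl, rfl, mul_left_cancel₀ hb (by linarith)⟩
  · obtain rfl : p = -a := mul_left_cancel₀ hb (by linarith)
    exact Or.inr ⟨rfl, rfl, mul_left_cancel₀ hb (by linarith)⟩

/-- If `A² = −I` and `B² = −I` in `SL(2,ℝ)`, then `AB = ±I` or
`|tr(AB)| > 2`. -/
theorem stmt_10 (A B : SL2R)
    (hA : ((A ^ 2 : SL2R) : Matrix (Fin 2) (Fin 2) ℝ) = -1)
    (hB : ((B ^ 2 : SL2R) : Matrix (Fin 2) (Fin 2) ℝ) = -1) :
    ((A * B : SL2R) : Matrix (Fin 2) (Fin 2) ℝ) = 1 ∨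
    ((A * B : SL2R) : Matrix (Fin 2) (Fin 2) ℝ) = -1 ∨
    2 < |trSL (A * B)| := by
  rw [Matrix.SpecialLinearGroup.coe_pow] at hA hB
  rw [trSL, Matrix.SpecialLinearGroup.coe_mul]
  obtain ⟨hAd, hAs, hAb⟩ := entries_of_sq_eq_neg_one hA
  obtain ⟨hBd, hBs, hBb⟩ := entries_of_sq_eq_neg_one hB
  by_cases hT : 2 < |((A : Matrix (Fin 2) (Fin 2) ℝ) * B).trace|
  · exact Or.inr (Or.inr hT)
  have htr : ((A : Matrix (Fin 2) (Fin 2) ℝ) * B).trace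
      = 2 * A 0 0 * B 0 0 + A 0 1 * B 1 0 + A 1 0 * B 0 1 := by
    rw [Matrix.trace_fin_two, Matrix.mul_apply, Matrix.mul_apply, Fin.sum_univ_two,
      Fin.sum_univ_two, hAd, hBd]
    ring
  rw [not_lt, htr] at hT
  rcases eq_or_eq_neg_of_abs_trace_mul_le hAs hBs hAb hBb hT with ⟨h0, h1, h2⟩ | ⟨h0, h1, h2⟩
  · have hBA : (B : Matrix (Fin 2) (Fin 2) ℝ) = A := by
      ext i j
      fin_cases i <;> fin_cases j <;> simp [h0, h1, h2, hAd, hBd]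
    exact Or.inr (Or.inl (by rw [hBA, ← pow_two, hA]))
  · have hBA : (B : Matrix (Fin 2) (Fin 2) ℝ) = -A := by
      ext i j
      fin_cases i <;> fin_cases j <;> simp [h0, h1, h2, hAd, hBd]
    exact Or.inl (by rw [hBA, mul_neg, ← pow_two, hA, neg_neg])
end

section
/- Let θ ∈ (0,2π) with θ/π irrational. Then there exists a dense subset S ⊆ (2,∞) such that for every ξ = (x,y,z) ∈ 𝔠_θ with x ∈ S, there exist r ∈ F₂ and an integer m ≥ 2 such that r(A_ξ, B_ξ) ≠ ±I but (r(A_ξ, B_ξ))^m = ±I; that is, ρ_ξ(r) is a nontrivial torsion element of PSL(2,ℝ) with ρ_ξ(r^m) = 1. -/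
lemma trSL_mul_comm (P Q : SL2R) : trSL (P * Q) = trSL (Q * P) := by
  simp only [trSL, Matrix.SpecialLinearGroup.coe_mul]
  exact Matrix.trace_mul_comm _ _

lemma trSL_conj (P Q : SL2R) : trSL (P * Q * P⁻¹) = trSL Q := by
  rw [trSL_mul_comm, inv_mul_cancel_left]

lemma trSL_mul_add_trSL_mul_inv (P Q : SL2R) :
    trSL (P * Q) + trSL (P * Q⁻¹) = trSL P * trSL Q := by
  simp only [trSL, Matrix.SpecialLinearGroup.coe_mul, Matrix.SpecialLinearGroup.coe_inv,
    Matrix.adjugate_fin_two, Matrix.trace_fin_two, Matrix.mul_apply, Fin.sum_univ_two,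
    Matrix.of_apply, Matrix.cons_val', Matrix.cons_val_zero, Matrix.cons_val_one,
    Matrix.cons_val_fin_one]
  ring

lemma zetaOf_add_inv {z : ℝ} (hz : 2 < z) : zetaOf z + (zetaOf z)⁻¹ = z := by
  have hs : Real.sqrt (z ^ 2 - 4) ^ 2 = z ^ 2 - 4 := Real.sq_sqrt (by nlinarith)
  have h0 := zetaOf_ne_zero z
  have hdef : zetaOf z = (z + Real.sqrt (z ^ 2 - 4)) / 2 := by simp [zetaOf, hz]
  have hquad : zetaOf z ^ 2 + 1 = z * zetaOf z := by
    rw [hdef]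
    linear_combination hs / 4
  field_simp
  linear_combination hquad

lemma trSL_Amat (x : ℝ) : trSL (Amat x) = x := by
  simp [trSL, Amat, Matrix.trace_fin_two]

/-- Fricke's trace identity for the commutator of the normal-form matrices. -/
lemma trSL_commutator (x y : ℝ) {z : ℝ} (hz : 2 < z) :
    trSL (Amat x * Bmat y z * (Amat x)⁻¹ * (Bmat y z)⁻¹) =
      x ^ 2 + y ^ 2 + z ^ 2 - x * y * z - 2 := by
  have h := zetaOf_add_inv hz
  have h1 : zetaOf z * (zetaOf z)⁻¹ = 1 := mul_inv_cancel₀ (zetaOf_ne_zero z)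
  have hA : (Amat x : Matrix (Fin 2) (Fin 2) ℝ) = !![x, -1; 1, 0] := rfl
  have hB : (Bmat y z : Matrix (Fin 2) (Fin 2) ℝ) = !![0, (zetaOf z)⁻¹; -(zetaOf z), y] := rfl
  simp only [trSL, Matrix.SpecialLinearGroup.coe_mul, Matrix.SpecialLinearGroup.coe_inv, hA, hB,
    Matrix.adjugate_fin_two_of, Matrix.mul_fin_two, Matrix.trace_fin_two_of]
  clear hA hB
  generalize (zetaOf z)⁻¹ = w at *
  generalize zetaOf z = v at *
  subst h
  linear_combination (x ^ 2 - 2) * h1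

/-- If `tr [A, B] = 2 cos φ`, then `tr (A [A, B]ⁿ) = tr A · cos ((n + 1/2) φ) / cos (φ / 2)`. -/
lemma trSL_mul_commutator_zpow (A B : SL2R) {φ : ℝ}
    (hC : trSL (A * B * A⁻¹ * B⁻¹) = 2 * Real.cos φ) (n : ℤ) :
    trSL (A * (A * B * A⁻¹ * B⁻¹) ^ n) * Real.cos (φ / 2) =
      trSL A * Real.cos ((n + 1 / 2) * φ) := by
  have hinv : trSL (A * (A * B * A⁻¹ * B⁻¹)⁻¹) = trSL A := by
    have : A * (A * B * A⁻¹ * B⁻¹)⁻¹ = (A * B) * A * (A * B)⁻¹ := by group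
    rw [this, trSL_conj]
  set C := A * B * A⁻¹ * B⁻¹
  have hrec (k : ℤ) :
      trSL (A * C ^ (k + 1)) + trSL (A * C ^ (k - 1)) = trSL (A * C ^ k) * (2 * Real.cos φ) := by
    rw [← hC, ← trSL_mul_add_trSL_mul_inv, mul_assoc, mul_assoc, zpow_add_one, zpow_sub_one]
  have hcos (s : ℝ) : Real.cos ((s + 1 + 1 / 2) * φ) + Real.cos ((s - 1 + 1 / 2) * φ) =
      Real.cos ((s + 1 / 2) * φ) * (2 * Real.cos φ) := by
    rw [show (s + 1 + 1 / 2) * φ = (s + 1 / 2) * φ + φ by ring,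
      show (s - 1 + 1 / 2) * φ = (s + 1 / 2) * φ - φ by ring, Real.cos_add, Real.cos_sub]
    ring
  have key : ∀ k : ℤ, trSL (A * C ^ k) * Real.cos (φ / 2) =
        trSL A * Real.cos ((k + 1 / 2) * φ) ∧
      trSL (A * C ^ (k - 1)) * Real.cos (φ / 2) =
        trSL A * Real.cos (((k : ℝ) - 1 + 1 / 2) * φ) := by
    intro k
    induction k using Int.induction_on with
    | zero =>
      constructor
      · norm_num [div_eq_inv_mul]
      · rw [zero_sub, zpow_neg_one, hinv, ← Real.cos_neg]
        congr 2
        push_cast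
        ring
    | succ i ih =>
      refine ⟨?_, ?_⟩
      · have h1 := hrec i
        have h2 := hcos i
        push_cast at ih ⊢
        linear_combination Real.cos (φ / 2) * h1 - ih.2 + 2 * Real.cos φ * ih.1 - trSL A * h2
      · push_cast at ih ⊢
        simpa using ih.1
    | pred i ih =>
      refine ⟨by simpa using ih.2, ?_⟩
      have h1 := hrec (-i - 1)
      have h2 := hcos (-i - 1)
      simp only [sub_add_cancel] at h1 h2
      push_cast at ih ⊢
      linear_combination Real.cos (φ / 2) * h1 - ih.1 + 2 * Real.cos φ * ih.2 - trSL A * h2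
  exact (key n).1

lemma coe_pow_three_eq_neg_one {P : SL2R} (hP : trSL P = 1) :
    ((P ^ 3 : SL2R) : Matrix (Fin 2) (Fin 2) ℝ) = -1 := by
  have hdet := P.det_coe
  rw [Matrix.det_fin_two] at hdet
  rw [trSL, Matrix.trace_fin_two] at hP
  have hch : (P : Matrix (Fin 2) (Fin 2) ℝ) ^ 2 = P - 1 := by
    ext i j
    fin_cases i <;> fin_cases j <;>
      simp [pow_two, Matrix.mul_apply, Fin.sum_univ_two]
    · linear_combination P.1 0 0 * hP - hdet
    · linear_combination P.1 0 1 * hP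
    · linear_combination P.1 1 0 * hP
    · linear_combination P.1 1 1 * hP - hdet
  rw [Matrix.SpecialLinearGroup.coe_pow, pow_succ, hch, sub_mul, one_mul, ← pow_two, hch]
  abel

/-- The values `κ / cos ((n + 1/2) φ)` exceeding `2` are dense in `(2, ∞)`. -/
lemma Ioi_two_subset_closure {φ κ : ℝ} (hφ : Irrational (φ / (2 * Real.pi)))
    (hκ0 : 0 < κ) (hκ1 : κ ≤ 1) :
    Set.Ioi (2 : ℝ) ⊆
      closure {x | 2 < x ∧ ∃ n : ℤ, x * Real.cos ((n + 1 / 2) * φ) = κ} := by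
  intro x hx
  have hx2 : (2 : ℝ) < x := hx
  rw [mem_closure_iff]
  intro o ho hxo
  have hcos : Real.cos (Real.arccos (κ / x)) = κ / x := by
    have h0 : 0 < κ / x := by positivity
    refine Real.cos_arccos (by linarith) ?_
    rw [div_le_one (by linarith)]
    linarith
  have hval : κ / Real.cos (Real.arccos (κ / x)) = x := by
    rw [hcos]
    field_simp
  have hcont : ContinuousAt (fun u ↦ κ / Real.cos u) (Real.arccos (κ / x)) := by
    refine continuousAt_const.div Real.continuous_cos.continuousAt ?_
    rw [hcos]
    positivity
  have hnhds : o ∩ Set.Ioi 2 ∈ nhds (κ / Real.cos (Real.arccos (κ / x))) := by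
    rw [hval]
    exact (ho.inter isOpen_Ioi).mem_nhds ⟨hxo, hx⟩
  obtain ⟨U, hUsub, hU, hmem⟩ := mem_nhds_iff.mp (hcont hnhds)
  have hdense := dense_addSubgroupClosure_pair_iff.mpr hφ
  obtain ⟨g, hg, hgU⟩ := hdense.exists_mem_open
    (hU.preimage (continuous_add_const (φ / 2)))
    ⟨Real.arccos (κ / x) - φ / 2, by simpa using hmem⟩
  obtain ⟨a, b, rfl⟩ := AddSubgroup.mem_closure_pair.mp hg
  obtain ⟨hgo, hg2⟩ := hUsub hgU
  have hperiod : Real.cos (a • φ + b • (2 * Real.pi) + φ / 2) =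
      Real.cos ((a + 1 / 2) * φ) := by
    rw [← Real.cos_add_int_mul_two_pi ((a + 1 / 2) * φ) b, zsmul_eq_mul, zsmul_eq_mul]
    congr 1
    ring
  simp only [Set.mem_Ioi, hperiod] at hgo hg2
  refine ⟨_, hgo, hg2, a, div_mul_cancel₀ _ fun h ↦ ?_⟩
  rw [h, div_zero] at hg2
  norm_num at hg2

/-- For `θ ∈ (0,2π)` with `θ/π` irrational, there is a dense subset
`S ⊆ (2,∞)` such that every `ξ ∈ 𝔠_θ` with `x`-coordinate in `S` has a nontrivial torsion
element `ρ_ξ(r)` in the image: `r(A_ξ,B_ξ) ≠ ±I` but `(r(A_ξ,B_ξ))^m = ±I` for some `m ≥ 2`. -/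
theorem stmt_11 (θ : ℝ) (hθ : θ ∈ Set.Ioo 0 (2 * Real.pi))
    (hirr : Irrational (θ / Real.pi)) :
    ∃ S : Set ℝ, S ⊆ Set.Ioi 2 ∧ Set.Ioi (2:ℝ) ⊆ closure S ∧
      ∀ ξ ∈ FK θ, ξ.1 ∈ S →
        ∃ (r : F2) (m : ℕ), 2 ≤ m ∧
          ((rho ξ r : Matrix (Fin 2) (Fin 2) ℝ) ≠ 1 ∧
           (rho ξ r : Matrix (Fin 2) (Fin 2) ℝ) ≠ -1) ∧
          ((rho ξ (r ^ m) : Matrix (Fin 2) (Fin 2) ℝ) = 1 ∨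
           (rho ξ (r ^ m) : Matrix (Fin 2) (Fin 2) ℝ) = -1) := by
  obtain ⟨hθ0, hθ1⟩ := hθ
  set φ := Real.pi - θ / 2 with hφdef
  have hpi := Real.pi_pos
  have hκ : 0 < Real.cos (φ / 2) :=
    Real.cos_pos_of_mem_Ioo ⟨by linarith, by linarith⟩
  have hφ : Irrational (φ / (2 * Real.pi)) := by
    have h : φ / (2 * Real.pi) = ((1 / 2 : ℚ) : ℝ) - θ / Real.pi / (4 : ℕ) := by
      rw [hφdef]
      push_cast
      field_simp
      ring
    rw [h]
    exact (hirr.div_natCast (by norm_num)).ratCast_sub _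
  refine ⟨_, fun x hx ↦ hx.1, Ioi_two_subset_closure hφ hκ (Real.cos_le_one _), ?_⟩
  rintro ⟨x, y, z⟩ ⟨-, -, hz, htr⟩ ⟨hx2, n, hn⟩
  dsimp only at hz htr hx2 hn
  have hC : trSL (Amat x * Bmat y z * (Amat x)⁻¹ * (Bmat y z)⁻¹) = 2 * Real.cos φ := by
    rw [trSL_commutator x y hz, htr, hφdef, Real.cos_pi_sub]
    ring
  have hr : rho (x, y, z) (Xg * (Xg * Yg * Xg⁻¹ * Yg⁻¹) ^ n) =
      Amat x * (Amat x * Bmat y z * (Amat x)⁻¹ * (Bmat y z)⁻¹) ^ n := by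
    simp [rho, ev, Xg, Yg]
  have htrace : trSL (rho (x, y, z) (Xg * (Xg * Yg * Xg⁻¹ * Yg⁻¹) ^ n)) = 1 := by
    have h := trSL_mul_commutator_zpow (Amat x) (Bmat y z) hC n
    rw [trSL_Amat, hn] at h
    rw [hr]
    exact mul_right_cancel₀ hκ.ne' (h.trans (one_mul _).symm)
  refine ⟨_, 3, by norm_num, ⟨fun h ↦ ?_, fun h ↦ ?_⟩,
    Or.inr (by rw [map_pow]; exact coe_pow_three_eq_neg_one htrace)⟩ <;>
  · rw [trSL, h] at htrace
    norm_num [Matrix.trace_fin_two] at htrace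
end

section
/- Let θ ∈ (0,2π) with θ/π irrational. Then the set of points ξ ∈ 𝔠_θ for which ker ρ_ξ contains a palindromic word of non-torsion-type — i.e., there exists u ∈ F₂ palindromic, of non-torsion-type, with u(A_ξ, B_ξ) = ±I — is dense in 𝔠_θ. -/
/-- A word is of torsion-type if it lies in the normal closure of `{r^m}`
for some `r ≠ 1` and `m ≥ 2`. -/
def TorsionType (u : F2) : Prop :=
  ∃ r : F2, r ≠ 1 ∧ ∃ m : ℕ, 2 ≤ m ∧ u ∈ Subgroup.normalClosure {r ^ m}

open scoped Matrix.Norms.Operator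

/-- Real `2 × 2` matrices. -/
abbrev Mat2 := Matrix (Fin 2) (Fin 2) ℝ

namespace Mat2

lemma adjugate_eq (X : Mat2) : X.adjugate = X.trace • (1 : Mat2) - X := by
  ext i j
  fin_cases i <;> fin_cases j <;>
    simp [Matrix.adjugate_fin_two, Matrix.trace_fin_two]

lemma mul_self_eq (X : Mat2) : X * X = X.trace • X - X.det • (1 : Mat2) := by
  ext i j
  fin_cases i <;> fin_cases j <;>
    simp [Matrix.mul_apply, Fin.sum_univ_two, Matrix.trace_fin_two, Matrix.det_fin_two] <;> ring

lemma mul_add_mul_comm {X Y : Mat2} (hX : X.trace = 0) (hY : Y.trace = 0) :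
    X * Y + Y * X = (X * Y).trace • (1 : Mat2) := by
  have h1 : X 1 1 = - X 0 0 := by rw [Matrix.trace_fin_two] at hX; linarith
  have h2 : Y 1 1 = - Y 0 0 := by rw [Matrix.trace_fin_two] at hY; linarith
  ext i j
  fin_cases i <;> fin_cases j <;>
    simp [Matrix.mul_apply, Fin.sum_univ_two, Matrix.trace_fin_two, h1, h2] <;> ring

/-- Traceless matrices of determinant one: the lifts to `SL(2,ℝ)` of half-turns of the
hyperbolic plane. -/
structure IsHalfTurn (X : Mat2) : Prop where
  trace_eq : X.trace = 0
  det_eq : X.det = 1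

namespace IsHalfTurn

variable {J P R X : Mat2}

lemma mul_self (h : IsHalfTurn X) : X * X = -1 := by
  rw [mul_self_eq, h.trace_eq, h.det_eq]; simp

lemma entry (h : IsHalfTurn X) : X 1 1 = - X 0 0 := by
  have := h.trace_eq
  rw [Matrix.trace_fin_two] at this; linarith

lemma det_entry (h : IsHalfTurn X) : X 0 0 * X 0 0 + X 0 1 * X 1 0 = -1 := by
  have := h.det_eq
  rw [Matrix.det_fin_two, h.entry] at this; linarith

lemma conj (hP : IsHalfTurn P) (hX : IsHalfTurn X) : IsHalfTurn (-(P * X * P)) := by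
  constructor
  · rw [Matrix.trace_neg, Matrix.trace_mul_comm, ← mul_assoc, hP.mul_self]
    simp [hX.trace_eq]
  · rw [Matrix.det_neg]; simp [hP.det_eq, hX.det_eq]

lemma conj_adjugate (hX : IsHalfTurn X) {g : Mat2} (hg : g.det = 1) :
    IsHalfTurn (g * X * g.adjugate) := by
  constructor
  · rw [Matrix.trace_mul_comm, ← mul_assoc, Matrix.adjugate_mul, hg]
    simp [hX.trace_eq]
  · simp [Matrix.det_adjugate, hg, hX.det_eq]

lemma adjugate (hX : IsHalfTurn X) : X.adjugate = -X := by
  rw [adjugate_eq, hX.trace_eq]; simp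

end IsHalfTurn

/-- The rotation `cos t + J sin t`. -/
noncomputable def rot (J : Mat2) (t : ℝ) : Mat2 := Real.cos t • (1 : Mat2) + Real.sin t • J

lemma rot_zero (J : Mat2) : rot J 0 = 1 := by simp [rot]

lemma rot_add {J : Mat2} (hJ : IsHalfTurn J) (s t : ℝ) : rot J (s + t) = rot J s * rot J t := by
  simp only [rot, Real.cos_add, Real.sin_add, add_mul, mul_add, smul_mul_assoc, mul_smul_comm,
    hJ.mul_self, one_mul, mul_one]
  module

lemma rot_mul_neg {J : Mat2} (hJ : IsHalfTurn J) (t : ℝ) : rot J t * rot J (-t) = 1 := by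
  rw [← rot_add hJ]; simp [rot_zero]

lemma adjugate_rot {J : Mat2} (hJ : IsHalfTurn J) (t : ℝ) : (rot J t).adjugate = rot J (-t) := by
  rw [adjugate_eq]
  simp only [rot, Matrix.trace_add, Matrix.trace_smul, hJ.trace_eq, Matrix.trace_one,
    Real.cos_neg, Real.sin_neg, Fintype.card_fin, smul_eq_mul]
  push_cast
  module

lemma det_rot {J : Mat2} (hJ : IsHalfTurn J) (t : ℝ) : (rot J t).det = 1 := by
  have h := Matrix.mul_adjugate (rot J t)
  rw [adjugate_rot hJ, rot_mul_neg hJ] at h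
  have := congrFun (congrFun h 0) 0
  simpa using this.symm

lemma rot_add_int_mul_two_pi (J : Mat2) (t : ℝ) (n : ℤ) :
    rot J (t + n * (2 * Real.pi)) = rot J t := by
  simp [rot, Real.cos_add_int_mul_two_pi, Real.sin_add_int_mul_two_pi]

lemma eq_of_commute {J X : Mat2} (hJ : IsHalfTurn J) (h : X * J = J * X) :
    X = (X.trace / 2) • (1 : Mat2) + (-(J * X).trace / 2) • J := by
  set Y : Mat2 := X - (X.trace / 2) • (1 : Mat2) with hY
  have hYt : Y.trace = 0 := by simp [hY]
  have hXY : X = Y + (X.trace / 2) • (1 : Mat2) := by simp [hY]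
  have hc : Y * J = J * Y := by simp [hY, sub_mul, mul_sub, h]
  have h1 := mul_add_mul_comm hJ.trace_eq hYt
  have h2 : (J * Y).trace = (J * X).trace := by simp [hY, mul_sub, hJ.trace_eq]
  rw [hc, h2] at h1
  have h3 := congrArg (fun Z => J * Z) h1
  simp only [mul_add, ← mul_assoc, hJ.mul_self, mul_smul_comm, mul_one, neg_mul, one_mul] at h3
  have h4 : Y = (-(J * X).trace / 2) • J := by
    have : (2 : ℝ) • Y = (-(J * X).trace) • J := by
      rw [neg_smul, ← h3]; module
    rw [div_eq_inv_mul, mul_smul, ← this, smul_smul]; norm_num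
  nth_rewrite 1 [hXY]
  rw [h4]; abel

/-- The component of the half-turn `U` orthogonal to the half-turn `J`. -/
noncomputable def perp (J U : Mat2) : Mat2 := U + ((J * U).trace / 2) • J

section perp

variable {J U : Mat2} (hJ : IsHalfTurn J) (hU : IsHalfTurn U)
include hJ hU

lemma trace_perp : (perp J U).trace = 0 := by
  simp [perp, hU.trace_eq, hJ.trace_eq]

lemma mul_perp : J * perp J U = -(perp J U * J) := by
  have h1 := mul_add_mul_comm hJ.trace_eq (trace_perp hJ hU)
  have h2 : (J * perp J U).trace = 0 := by
    simp [perp, mul_add, hJ.mul_self]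
  rw [h2, zero_smul] at h1
  exact eq_neg_of_add_eq_zero_left h1

lemma perp_mul_perp :
    perp J U * perp J U = ((J * U).trace ^ 2 / 4 - 1) • (1 : Mat2) := by
  have h1 := mul_add_mul_comm hJ.trace_eq hU.trace_eq
  have h2 : U * J = (J * U).trace • (1 : Mat2) - J * U := by rw [← h1]; abel
  simp only [perp, add_mul, mul_add, smul_mul_assoc, mul_smul_comm, hJ.mul_self, hU.mul_self, h2]
  module

lemma det_perp : (perp J U).det = 1 - (J * U).trace ^ 2 / 4 := by
  have h := mul_self_eq (perp J U)
  rw [trace_perp hJ hU, perp_mul_perp hJ hU] at h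
  have := congrFun (congrFun h 0) 0
  simp at this
  linarith

end perp

/-- If two half-turns are at the same distance from the half-turn `J`, a rotation fixing `J` takes
one to the other. -/
lemma exists_rotation {J U V : Mat2} (hJ : IsHalfTurn J) (hU : IsHalfTurn U) (hV : IsHalfTurn V)
    (h : (J * U).trace = (J * V).trace) (hU1 : (J * U).trace < -2) :
    ∃ a b : ℝ, a ^ 2 + b ^ 2 = 1 ∧ a = (perp J V * perp J U).trace / (2 * ((J * U).trace ^ 2 / 4 - 1))
      ∧ b = -(J * (perp J V * perp J U)).trace / (2 * ((J * U).trace ^ 2 / 4 - 1)) ∧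
      perp J V = (a • (1 : Mat2) + b • J) * perp J U := by
  set d := (J * U).trace ^ 2 / 4 - 1 with hd
  have hd0 : 0 < d := by rw [hd]; nlinarith
  have hcomm : perp J V * perp J U * J = J * (perp J V * perp J U) := by
    rw [mul_assoc, ← neg_eq_iff_eq_neg.mpr (mul_perp hJ hU), mul_neg, ← mul_assoc, ← neg_mul,
      ← mul_perp hJ hV, mul_assoc]
  have h1 := eq_of_commute hJ hcomm
  set a := (perp J V * perp J U).trace / (2 * d) with ha
  set b := -(J * (perp J V * perp J U)).trace / (2 * d) with hb
  have key : perp J V = (a • (1 : Mat2) + b • J) * perp J U := by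
    have h2 := congrArg (fun Z => d⁻¹ • (Z * perp J U)) h1
    simp only [mul_assoc, perp_mul_perp hJ hU, ← hd] at h2
    rw [mul_smul_comm, mul_one, smul_smul, inv_mul_cancel₀ hd0.ne', one_smul] at h2
    rw [h2, ← smul_mul_assoc, smul_add, smul_smul, smul_smul, ha, hb]
    congr 3 <;> field_simp
  refine ⟨a, b, ?_, rfl, rfl, key⟩
  have h3 := congrArg Matrix.det key
  rw [Matrix.det_mul, det_perp hJ hU, det_perp hJ hV, ← h, ← neg_sub, ← hd] at h3
  have h4 : (a • (1 : Mat2) + b • J).det = a ^ 2 + b ^ 2 := by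
    have := hJ.det_entry
    rw [Matrix.det_fin_two]
    simp [hJ.entry]
    linear_combination -b ^ 2 * this
  rw [h4] at h3
  nlinarith

lemma perp_conj_rot {J U : Mat2} (hJ : IsHalfTurn J) (hU : IsHalfTurn U) (t : ℝ) :
    rot J t * U * rot J (-t) = (-((J * U).trace / 2)) • J + rot J (2 * t) * perp J U := by
  have h1 : U = perp J U - ((J * U).trace / 2) • J := by simp [perp]
  have hcJ : rot J t * J = J * rot J t := by simp [rot, add_mul, mul_add]
  have hcP : perp J U * rot J (-t) = rot J t * perp J U := by
    simp [rot, add_mul, mul_add, mul_perp hJ hU]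
  nth_rewrite 1 [h1]
  rw [mul_sub, sub_mul, mul_assoc _ (perp J U), hcP, ← mul_assoc, ← rot_add hJ, mul_smul_comm, hcJ,
    smul_mul_assoc, mul_assoc, rot_mul_neg hJ, mul_one, two_mul]
  module

lemma exists_rot_conj {J U V : Mat2} (hJ : IsHalfTurn J) (hU : IsHalfTurn U) (hV : IsHalfTurn V)
    (h : (J * U).trace = (J * V).trace) (hU1 : (J * U).trace < -2) :
    ∃ t : ℝ, rot J t * U * rot J (-t) = V := by
  obtain ⟨a, b, hab, -, -, hV'⟩ := exists_rotation hJ hU hV h hU1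
  have hc : ‖(⟨a, b⟩ : ℂ)‖ = 1 := by
    rw [Complex.norm_def, Complex.normSq_mk]
    rw [show a * a + b * b = 1 by linarith]; simp
  refine ⟨(⟨a, b⟩ : ℂ).arg / 2, ?_⟩
  have hne : (⟨a, b⟩ : ℂ) ≠ 0 := by
    intro h0; rw [h0] at hc; simp at hc
  rw [perp_conj_rot hJ hU, mul_div_cancel₀ _ (two_ne_zero), rot, Complex.cos_arg hne,
    Complex.sin_arg, hc]
  simp only [div_one]
  rw [← hV', h, perp]
  module

/-- A half-turn is determined by its distance to `J` and by its direction seen from `J`. -/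
lemma eq_of_trace_eq {J U V : Mat2} (hJ : IsHalfTurn J) (hU : IsHalfTurn U) (hV : IsHalfTurn V)
    (h : (J * U).trace = (J * V).trace) (hU1 : (J * U).trace < -2)
    (hS : ((J * U - U * J) * V).trace = 0)
    (hpos : 0 < (perp J V * perp J U).trace) : V = U := by
  obtain ⟨a, b, hab, ha, hb, hV'⟩ := exists_rotation hJ hU hV h hU1
  have hd0 : 0 < (J * U).trace ^ 2 / 4 - 1 := by nlinarith
  have hb0 : b = 0 := by
    rw [hb]
    have : (J * (perp J V * perp J U)).trace = 0 := by
      have h1 : (J * U * V).trace + (J * V * U).trace = 0 := by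
        rw [mul_assoc, mul_assoc, ← Matrix.trace_add, ← mul_add,
          mul_add_mul_comm hU.trace_eq hV.trace_eq]
        simp [hJ.trace_eq]
      have h2 : (J * U * V).trace - (J * V * U).trace = 0 := by
        rw [← hS, sub_mul, Matrix.trace_sub, Matrix.trace_mul_cycle U J V,
          Matrix.trace_mul_cycle V U J]
      have h3 : (J * V * J).trace = 0 := by
        rw [Matrix.trace_mul_comm, ← mul_assoc, hJ.mul_self]; simp [hV.trace_eq]
      simp only [perp, mul_add, add_mul, mul_smul_comm, smul_mul_assoc, hJ.mul_self,
        Matrix.trace_add, Matrix.trace_smul, ← mul_assoc, h3]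
      simp [hJ.trace_eq, hU.trace_eq]
      linarith
    rw [this]; simp
  have ha0 : 0 < a := by rw [ha]; positivity
  have ha1 : a = 1 := by
    rw [hb0] at hab
    nlinarith
  rw [hb0, ha1] at hV'
  simp only [one_smul, zero_smul, add_zero, one_mul, perp, ← h] at hV'
  exact add_right_cancel hV'

/-- The commutator-like word `(E(s)E'(s))³(E(-s)E'(-s))³`. -/
def relWord {T G : Type*} [Neg T] [Monoid G] (E E' : T → G) (s : T) : G :=
  (E s * E' s) ^ 3 * (E (-s) * E' (-s)) ^ 3

/-- The factor moving one half-turn onto another at the base point. -/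
def moveWord {T G : Type*} [Monoid G] (E₀ E₁ E₂ : T → G) (m n : ℕ) (s t : T) : G :=
  (E₂ s * E₀ s) ^ m * E₀ t * (E₀ s * E₁ s) ^ n

/-- The words used to move one half-turn onto another. -/
def conjWord {T G : Type*} [Neg T] [Monoid G] (E₀ E₁ E₂ : T → G) (k l m n : ℕ) (s : Fin 4 → T) :
    G :=
  relWord E₀ E₁ (s 0) ^ k * relWord E₀ E₂ (s 1) ^ l * moveWord E₀ E₁ E₂ m n (s 2) (s 3)

lemma trace_pow_ge {H : Mat2} {χ : ℝ} (hdet : H.det = 1) (htr : H.trace = 2 * χ) (hχ : 1 < χ)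
    (n : ℕ) : 2 + 2 * n * (χ - 1) ≤ (H ^ n).trace ∧
      2 * (χ - 1) ≤ (H ^ (n + 1)).trace - (H ^ n).trace := by
  induction n with
  | zero => simp [htr]; linarith
  | succ n ih =>
    obtain ⟨h1, h2⟩ := ih
    have hrec : (H ^ (n + 2)).trace = 2 * χ * (H ^ (n + 1)).trace - (H ^ n).trace := by
      rw [pow_add, pow_two, mul_self_eq, hdet, htr]
      simp [mul_sub, pow_succ]
    have hn : (0 : ℝ) ≤ n := Nat.cast_nonneg n
    have h3 : 0 ≤ n * (χ - 1) := mul_nonneg hn (by linarith)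
    refine ⟨by push_cast; linarith, ?_⟩
    rw [hrec]
    nlinarith

lemma continuous_rot (J : Mat2) : Continuous (rot J) := by
  unfold rot; fun_prop

section transitivity

variable {J P R : Mat2} (hJ : IsHalfTurn J) (hP : IsHalfTurn P)
include hJ hP

lemma trace_conj_pow (k : ℕ) :
    (J * ((J * -(P * J * P)) ^ k * P * ((J * -(P * J * P)) ^ k).adjugate)).trace =
      (P * J * (-(J * P)) ^ (4 * k)).trace := by
  have hadj : (J * -(P * J * P)).adjugate = -(P * J * (P * J)) := by
    rw [Matrix.adjugate_mul_distrib, hJ.adjugate, (hP.conj hJ).adjugate]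
    simp [mul_assoc]
  have hsc : SemiconjBy P (-(P * J * (P * J))) (-(J * P * (J * P))) := by
    have h (X : Mat2) : P * (P * X) = -X := by rw [← mul_assoc, hP.mul_self]; simp
    simp [SemiconjBy, mul_assoc, h, hP.mul_self]
  have h1 : J * -(P * J * P) = -(J * P * (J * P)) := by simp [mul_assoc]
  have h2 : (-(J * P * (J * P))) ^ 2 = (-(J * P)) ^ 4 := by
    simp [pow_succ, mul_assoc]
  rw [Matrix.adjugate_pow, hadj, mul_assoc, (hsc.pow_right k).eq, h1, ← mul_assoc, ← mul_assoc,
    Matrix.trace_mul_comm, mul_assoc J, ← pow_add, ← two_mul, pow_mul, h2, ← pow_mul, mul_assoc]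

lemma exists_trace_le (hχ : (J * P).trace < -2) (C : ℝ) :
    ∃ k : ℕ, (J * ((J * -(P * J * P)) ^ k * P * ((J * -(P * J * P)) ^ k).adjugate)).trace ≤ C := by
  set χ := -(J * P).trace / 2 with hχd
  have hχ1 : 1 < χ := by rw [hχd]; linarith
  obtain ⟨n, hn⟩ := exists_nat_gt (-C / (2 * (χ - 1)))
  refine ⟨n + 1, ?_⟩
  rw [trace_conj_pow hJ hP]
  have hdet : (-(J * P)).det = 1 := by
    rw [Matrix.det_neg]; simp [hJ.det_eq, hP.det_eq]
  have htr : (-(J * P)).trace = 2 * χ := by rw [Matrix.trace_neg, hχd]; ring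
  have h1 := (trace_pow_ge hdet htr hχ1 (4 * n + 3)).1
  have h2 : P * J * (-(J * P)) ^ (4 * (n + 1)) = -(-(J * P)) ^ (4 * n + 3) := by
    have : P * J * -(J * P) = -1 := by
      have h3 : P * J * -(J * P) = -(P * (J * J) * P) := by simp [mul_assoc]
      rw [h3, hJ.mul_self]; simp [hP.mul_self]
    rw [show 4 * (n + 1) = 4 * n + 3 + 1 by ring, pow_succ', ← mul_assoc, this]
    simp
  rw [h2, Matrix.trace_neg]
  rw [div_lt_iff₀ (by linarith)] at hn
  push_cast at h1
  have hn0 : (0 : ℝ) ≤ n := Nat.cast_nonneg n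
  nlinarith

lemma det_pow_rot (t : ℝ) (k : ℕ) : ((rot J t * rot (-(P * J * P)) t) ^ k).det = 1 := by
  simp [det_rot hJ, det_rot (hP.conj hJ)]

lemma exists_conj_of_le (hR : IsHalfTurn R) (hχ : (J * P).trace < -2)
    (hle : (J * R).trace ≤ (J * P).trace) :
    ∃ (n : ℕ) (s t : ℝ), (rot J t * (rot J s * rot (-(P * J * P)) s) ^ n) * P *
      (rot J t * (rot J s * rot (-(P * J * P)) s) ^ n).adjugate = R := by
  obtain ⟨n, hn⟩ := exists_trace_le hJ hP hχ (J * R).trace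
  set f : ℝ → ℝ := fun s => (J * ((rot J s * rot (-(P * J * P)) s) ^ n * P *
    ((rot J s * rot (-(P * J * P)) s) ^ n).adjugate)).trace with hf
  have hcont : Continuous f := by
    have h1 := continuous_rot J
    have h2 := continuous_rot (-(P * J * P))
    simp only [hf]
    have h3 : Continuous fun s => (rot J s * rot (-(P * J * P)) s) ^ n := (h1.mul h2).pow n
    have h4 := h3.matrix_adjugate
    exact (continuous_const.mul ((h3.mul continuous_const).mul h4)).matrix_trace
  have h0 : f 0 = (J * P).trace := by simp [hf, rot_zero]
  have hrot (X : Mat2) : rot X (Real.pi / 2) = X := by simp [rot]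
  have h1 : f (Real.pi / 2) ≤ (J * R).trace := by simpa only [hf, hrot] using hn
  have hmem : (J * R).trace ∈ Set.Icc (f (Real.pi / 2)) (f 0) := ⟨h1, by rw [h0]; exact hle⟩
  obtain ⟨s, -, hs⟩ := intermediate_value_Icc' (by positivity) hcont.continuousOn hmem
  set g := (rot J s * rot (-(P * J * P)) s) ^ n with hg
  have hM : IsHalfTurn (g * P * g.adjugate) := hP.conj_adjugate (det_pow_rot hJ hP s n)
  have hs' : (J * (g * P * g.adjugate)).trace = (J * R).trace := hs
  obtain ⟨t, ht⟩ := exists_rot_conj hJ hM hR hs' (by linarith)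
  refine ⟨n, s, t, ?_⟩
  rw [Matrix.adjugate_mul_distrib, adjugate_rot hJ, ← hg, ← ht]
  simp only [mul_assoc]

lemma exists_moveWord (hR : IsHalfTurn R) (hχ : (J * P).trace < -2) (hχ' : (J * R).trace < -2) :
    ∃ (m n : ℕ) (s t : ℝ),
      moveWord (rot J) (rot (-(P * J * P))) (rot (-(R * J * R))) m n s t * P *
      (moveWord (rot J) (rot (-(P * J * P))) (rot (-(R * J * R))) m n s t).adjugate = R := by
  rcases le_total (J * R).trace (J * P).trace with h | h
  · obtain ⟨n, s, t, hst⟩ := exists_conj_of_le hJ hP hR hχ h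
    exact ⟨0, n, s, t, by simpa [moveWord] using hst⟩
  · obtain ⟨m, s, t, hst⟩ := exists_conj_of_le hJ hR hP hχ' h
    refine ⟨m, 0, -s, -t, ?_⟩
    set g := rot J t * (rot J s * rot (-(R * J * R)) s) ^ m with hg
    have hdet : g.det = 1 := by
      rw [hg, Matrix.det_mul, det_rot hJ, det_pow_rot hJ hR, one_mul]
    have hadj : moveWord (rot J) (rot (-(P * J * P))) (rot (-(R * J * R))) m 0 (-s) (-t) =
        g.adjugate := by
      rw [hg, Matrix.adjugate_mul_distrib, Matrix.adjugate_pow, Matrix.adjugate_mul_distrib,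
        adjugate_rot hJ, adjugate_rot hJ, adjugate_rot (hR.conj hJ)]
      simp [moveWord]
    have hgg : g.adjugate * g = 1 := by rw [Matrix.adjugate_mul, hdet, one_smul]
    clear_value g
    have hgR : g.adjugate * P * g = R := by
      rw [← hst, ← mul_assoc, ← mul_assoc, hgg, one_mul, mul_assoc, hgg, mul_one]
    rw [hadj, Matrix.adjugate_adjugate g (by simp)]
    simpa using hgR

end transitivity

open Filter Topology

lemma pow_three_eq {M : Mat2} (hM : M.det = 1) :
    M ^ 3 = (M.trace ^ 2 - 1) • M - M.trace • (1 : Mat2) := by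
  have h := mul_self_eq M
  rw [hM, one_smul] at h
  rw [pow_succ, pow_two, h, sub_mul, smul_mul_assoc, h, one_mul]
  module

section relation

variable {J P : Mat2} (hJ : IsHalfTurn J) (hP : IsHalfTurn P)
include hJ hP

lemma mul_conj_eq : J * -(P * J * P) = 1 - (J * P).trace • (J * P) := by
  have h := mul_self_eq (J * P)
  rw [Matrix.det_mul, hJ.det_eq, hP.det_eq, one_mul, one_smul] at h
  rw [mul_neg, ← neg_sub, ← h]; simp [mul_assoc]

lemma trace_rot_mul_rot (s : ℝ) :
    (rot J s * rot (-(P * J * P)) s).trace = 2 - Real.sin s ^ 2 * (J * P).trace ^ 2 := by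
  have h : (rot J s * rot (-(P * J * P)) s) = (Real.cos s ^ 2) • (1 : Mat2) +
      (Real.cos s * Real.sin s) • (J + -(P * J * P)) + Real.sin s ^ 2 • (J * -(P * J * P)) := by
    simp only [rot, add_mul, mul_add, smul_mul_assoc, mul_smul_comm, one_mul, mul_one]
    module
  rw [h, mul_conj_eq hJ hP]
  simp only [Matrix.trace_add, Matrix.trace_smul, hJ.trace_eq, (hP.conj hJ).trace_eq,
    Matrix.trace_sub, Matrix.trace_one, Fintype.card_fin, smul_eq_mul]
  push_cast
  linear_combination 2 * Real.sin_sq_add_cos_sq s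

lemma rot_mul_rot_add (s : ℝ) :
    rot J s * rot (-(P * J * P)) s + rot J (-s) * rot (-(P * J * P)) (-s) =
      (2 - Real.sin s ^ 2 * (J * P).trace ^ 2) • (1 : Mat2) -
        (Real.sin s ^ 2 * (J * P).trace) • (J * P - P * J) := by
  have h : rot J s * rot (-(P * J * P)) s + rot J (-s) * rot (-(P * J * P)) (-s) =
      (2 * Real.cos s ^ 2) • (1 : Mat2) + (2 * Real.sin s ^ 2) • (J * -(P * J * P)) := by
    simp only [rot, add_mul, mul_add, smul_mul_assoc, mul_smul_comm, one_mul, mul_one,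
      Real.cos_neg, Real.sin_neg]
    module
  have h2 := mul_add_mul_comm hJ.trace_eq hP.trace_eq
  have h3 : P * J = (J * P).trace • (1 : Mat2) - J * P := by rw [← h2]; abel
  rw [h, mul_conj_eq hJ hP, h3, Real.cos_sq']
  module

end relation

lemma differentiableAt_rot_mul_rot {J P : ℝ → Mat2} {t : ℝ} (hJ : DifferentiableAt ℝ J t)
    (hP : DifferentiableAt ℝ P t) (s : ℝ) :
    DifferentiableAt ℝ (fun t => rot (J t) s * rot (-(P t * J t * P t)) s) t := by
  have hrot {X : ℝ → Mat2} (hX : DifferentiableAt ℝ X t) :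
      DifferentiableAt ℝ (fun t => rot (X t) s) t :=
    (hX.const_smul (Real.sin s)).const_add (Real.cos s • (1 : Mat2))
  exact (hrot hJ).mul (hrot ((hP.mul hJ).mul hP).neg)

lemma relWord_eq_one {J P : Mat2} (hJ : IsHalfTurn J) (hP : IsHalfTurn P) {s : ℝ}
    (hs : Real.sin s ^ 2 * (J * P).trace ^ 2 = 1) :
    relWord (rot J) (rot (-(P * J * P))) s = 1 := by
  have h (t : ℝ) : (rot J t * rot (-(P * J * P)) t).det = 1 := by
    rw [Matrix.det_mul, det_rot hJ, det_rot (hP.conj hJ), one_mul]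
  rw [relWord, pow_three_eq (h s), pow_three_eq (h (-s)), trace_rot_mul_rot hJ hP,
    trace_rot_mul_rot hJ hP, Real.sin_neg, neg_sq, hs]
  norm_num

lemma hasDerivAt_relWord {J P : ℝ → Mat2} (hJd : DifferentiableAt ℝ J 0)
    (hPd : DifferentiableAt ℝ P 0) (hJ : ∀ᶠ t in 𝓝 0, IsHalfTurn (J t))
    (hP : ∀ᶠ t in 𝓝 0, IsHalfTurn (P t)) {s T' : ℝ}
    (hs : Real.sin s ^ 2 * (J 0 * P 0).trace ^ 2 = 1)
    (hT : HasDerivAt (fun t => (J t * P t).trace) T' 0) :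
    HasDerivAt (fun t => relWord (rot (J t)) (rot (-(P t * J t * P t))) s)
      ((-4 * T' / (J 0 * P 0).trace ^ 2) • (J 0 * P 0 - P 0 * J 0)) 0 := by
  have hJ0 := hJ.self_of_nhds
  have hP0 := hP.self_of_nhds
  set τ : ℝ → ℝ := fun t => 2 - Real.sin s ^ 2 * (J t * P t).trace ^ 2 with hτ
  have hτ0 : τ 0 = 1 := by simp only [hτ]; linarith
  have hT0 : (J 0 * P 0).trace ≠ 0 := by rintro h; rw [h] at hs; norm_num at hs
  have hτ' : HasDerivAt τ (-(Real.sin s ^ 2 * (2 * (J 0 * P 0).trace * T'))) 0 := by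
    have := ((hT.pow 2).const_mul (Real.sin s ^ 2)).const_sub 2
    simpa using this
  set τ' := -(Real.sin s ^ 2 * (2 * (J 0 * P 0).trace * T')) with hτd
  set M : ℝ → ℝ → Mat2 := fun u t => rot (J t) u * rot (-(P t * J t * P t)) u with hM
  have key (u : ℝ) : HasDerivAt (fun t => (τ t ^ 2 - 1) • M u t - τ t • (1 : Mat2))
      (τ' • ((2 : ℝ) • M u 0 - 1)) 0 := by
    have h1 := (((hτ'.pow 2).sub_const 1).fun_smul
      (differentiableAt_rot_mul_rot hJd hPd u).hasDerivAt).fun_sub (hτ'.smul_const (1 : Mat2))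
    refine h1.congr_deriv ?_
    simp only [hτ0, hM, Pi.pow_apply]
    norm_num
    module
  have hEq : (fun t => relWord (rot (J t)) (rot (-(P t * J t * P t))) s) =ᶠ[𝓝 0]
      fun t => ((τ t ^ 2 - 1) • M s t - τ t • (1 : Mat2)) *
        ((τ t ^ 2 - 1) • M (-s) t - τ t • (1 : Mat2)) := by
    filter_upwards [hJ, hP] with t hJt hPt
    have h (u : ℝ) : (M u t).det = 1 := by
      rw [hM, Matrix.det_mul, det_rot hJt, det_rot (hPt.conj hJt), one_mul]
    have h2 (u : ℝ) : (M u t).trace = 2 - Real.sin u ^ 2 * (J t * P t).trace ^ 2 :=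
      trace_rot_mul_rot hJt hPt u
    change M s t ^ 3 * M (-s) t ^ 3 = _
    rw [pow_three_eq (h s), pow_three_eq (h (-s)), h2, h2, Real.sin_neg, neg_sq]
  refine (((key s).fun_mul (key (-s))).congr_of_eventuallyEq hEq).congr_deriv ?_
  have hsum : M s 0 + M (-s) 0 = _ := rot_mul_rot_add hJ0 hP0 s
  have hM' : M (-s) 0 = (1 : Mat2) -
      (Real.sin s ^ 2 * (J 0 * P 0).trace) • (J 0 * P 0 - P 0 * J 0) - M s 0 := by
    rw [eq_sub_iff_add_eq, add_comm, hsum, hs]; norm_num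
  have hcoef : -4 * T' / (J 0 * P 0).trace ^ 2 =
      2 * τ' * (Real.sin s ^ 2 * (J 0 * P 0).trace) := by
    rw [hτd, div_eq_iff (pow_ne_zero 2 hT0)]
    linear_combination 4 * T' * (Real.sin s ^ 2 * (J 0 * P 0).trace ^ 2 + 1) * hs
  rw [hM', hcoef]
  simp only [hτ0]
  norm_num
  module

lemma hasDerivAt_pow_of_eq_one {v : ℝ → Mat2} {v' : Mat2} (hv : HasDerivAt v v' 0) (h1 : v 0 = 1)
    (k : ℕ) : HasDerivAt (fun t => v t ^ k) ((k : ℝ) • v') 0 := by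
  induction k with
  | zero =>
    simp only [pow_zero]
    exact (hasDerivAt_const (0 : ℝ) (1 : Mat2)).congr_deriv (by simp)
  | succ k ih =>
    simp only [pow_succ]
    refine (ih.fun_mul hv).congr_deriv ?_
    rw [h1]
    push_cast
    simp only [one_pow, one_mul, mul_one]
    module

/-- The trace, as a continuous linear map. -/
noncomputable def traceL : Mat2 →L[ℝ] ℝ := LinearMap.toContinuousLinearMap (Matrix.traceLinearMap _ ℝ ℝ)

@[simp] lemma traceL_apply (X : Mat2) : traceL X = X.trace := rfl

lemma hasDerivAt_trace {v : ℝ → Mat2} {v' : Mat2} (hv : HasDerivAt v v' 0) :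
    HasDerivAt (fun t => (v t).trace) v'.trace 0 :=
  traceL.hasFDerivAt.comp_hasDerivAt 0 hv

lemma hasDerivAt_adjugate {v : ℝ → Mat2} {v' : Mat2} (hv : HasDerivAt v v' 0)
    (h0 : v'.trace = 0) : HasDerivAt (fun t => (v t).adjugate) (-v') 0 := by
  simp only [adjugate_eq]
  refine ((hasDerivAt_trace hv).smul_const (1 : Mat2) |>.fun_sub hv).congr_deriv ?_
  simp [h0]

lemma hasDerivAt_conj_relWord {J P R M : ℝ → Mat2} {M' : Mat2} (hJd : DifferentiableAt ℝ J 0)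
    (hPd : DifferentiableAt ℝ P 0) (hRd : DifferentiableAt ℝ R 0)
    (hJ : ∀ᶠ t in 𝓝 0, IsHalfTurn (J t)) (hP : ∀ᶠ t in 𝓝 0, IsHalfTurn (P t))
    (hR : ∀ᶠ t in 𝓝 0, IsHalfTurn (R t)) {s₁ s₂ a b : ℝ}
    (hs₁ : Real.sin s₁ ^ 2 * (J 0 * P 0).trace ^ 2 = 1)
    (hs₂ : Real.sin s₂ ^ 2 * (J 0 * R 0).trace ^ 2 = 1)
    (ha : HasDerivAt (fun t => (J t * P t).trace) a 0)
    (hb : HasDerivAt (fun t => (J t * R t).trace) b 0)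
    (hM : HasDerivAt M M' 0) (hM0 : M 0 = R 0) (k l : ℕ) :
    HasDerivAt (fun t =>
      (relWord (rot (J t)) (rot (-(P t * J t * P t))) s₁ ^ k *
        relWord (rot (J t)) (rot (-(R t * J t * R t))) s₂ ^ l) * M t *
      (relWord (rot (J t)) (rot (-(P t * J t * P t))) s₁ ^ k *
        relWord (rot (J t)) (rot (-(R t * J t * R t))) s₂ ^ l).adjugate)
      (M' + (k * (-4 * a / (J 0 * P 0).trace ^ 2)) •
          ((J 0 * P 0 - P 0 * J 0) * R 0 - R 0 * (J 0 * P 0 - P 0 * J 0)) +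
        (l * (-4 * b / (J 0 * R 0).trace ^ 2)) •
          ((J 0 * R 0 - R 0 * J 0) * R 0 - R 0 * (J 0 * R 0 - R 0 * J 0))) 0 := by
  have e₁ := relWord_eq_one hJ.self_of_nhds hP.self_of_nhds hs₁
  have e₂ := relWord_eq_one hJ.self_of_nhds hR.self_of_nhds hs₂
  have h₁ := hasDerivAt_pow_of_eq_one (hasDerivAt_relWord hJd hPd hJ hP hs₁ ha) e₁ k
  have h₂ := hasDerivAt_pow_of_eq_one (hasDerivAt_relWord hJd hRd hJ hR hs₂ hb) e₂ l
  have h := h₁.fun_mul h₂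
  rw [e₁, e₂] at h
  simp only [one_pow, one_mul, mul_one] at h
  have htr : ∀ X : Mat2, (J 0 * X - X * J 0).trace = 0 := fun X => by
    rw [Matrix.trace_sub, Matrix.trace_mul_comm, sub_self]
  have h' := hasDerivAt_adjugate h (by simp [htr, -Matrix.trace_sub])
  refine ((h.fun_mul hM).fun_mul h').congr_deriv ?_
  rw [e₁, e₂, hM0]
  simp only [one_pow, one_mul, mul_one, Matrix.adjugate_one, smul_smul, add_mul, mul_add, mul_neg,
    smul_mul_assoc, mul_smul_comm]
  module

lemma trace_bracket_mul_bracket_self (J R : Mat2) :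
    ((J * R - R * J) * ((J * R - R * J) * R - R * (J * R - R * J))).trace = 0 := by
  rw [mul_sub, Matrix.trace_sub, sub_eq_zero, ← mul_assoc, ← mul_assoc, Matrix.trace_mul_comm,
    ← mul_assoc, Matrix.trace_mul_comm, ← mul_assoc]

section brackets

variable {J P R : Mat2} (hJ : IsHalfTurn J) (hR : IsHalfTurn R)
include hJ hR

lemma mul_comm_of_isHalfTurn : R * J = (J * R).trace • (1 : Mat2) - J * R := by
  rw [← mul_add_mul_comm hJ.trace_eq hR.trace_eq]; abel

lemma trace_mul_bracket_self :
    (J * ((J * R - R * J) * R - R * (J * R - R * J))).trace = 8 - 2 * (J * R).trace ^ 2 := by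
  have h : J * ((J * R - R * J) * R - R * (J * R - R * J)) =
      J * J * (R * R) - J * R * (J * R) - J * R * (J * R) + J * (R * R) * J := by noncomm_ring
  have h2 := mul_self_eq (J * R)
  rw [Matrix.det_mul, hJ.det_eq, hR.det_eq, one_mul, one_smul] at h2
  rw [h, h2, hR.mul_self, hJ.mul_self]
  simp [hJ.mul_self, Matrix.trace_add, Matrix.trace_sub]
  ring

lemma trace_bracket_mul_bracket :
    ((J * R - R * J) * ((J * P - P * J) * R - R * (J * P - P * J))).trace =
      2 * (J * R).trace * ((J * P - P * J) * R).trace := by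
  have h0 : ((J * R - R * J) * ((J * P - P * J) * R - R * (J * P - P * J))).trace =
      ((R * (J * R - R * J) - (J * R - R * J) * R) * (J * P - P * J)).trace := by
    rw [mul_sub, sub_mul (R * _), Matrix.trace_sub, Matrix.trace_sub, ← mul_assoc, ← mul_assoc,
      Matrix.trace_mul_comm _ R, mul_assoc R]
  have h1 : R * (J * R - R * J) - (J * R - R * J) * R =
      (2 * (J * R).trace) • R + (4 : ℝ) • J := by
    have : R * (J * R - R * J) - (J * R - R * J) * R = 2 * (R * J * R) - R * R * J - J * (R * R) := by
      noncomm_ring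
    rw [this, mul_comm_of_isHalfTurn hJ hR, hR.mul_self, sub_mul, mul_assoc J, hR.mul_self]
    simp only [smul_mul_assoc, one_mul, mul_neg, neg_mul, mul_one, two_mul]
    module
  have h2 : (J * (J * P - P * J)).trace = 0 := by
    rw [mul_sub, Matrix.trace_sub, ← mul_assoc, ← mul_assoc, Matrix.trace_mul_comm (J * P),
      ← mul_assoc, sub_self]
  rw [h0, h1, add_mul, Matrix.trace_add, smul_mul_assoc, smul_mul_assoc, Matrix.trace_smul,
    Matrix.trace_smul, h2, Matrix.trace_mul_comm R]
  simp

end brackets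

section smoothness

variable {E : Type*} [NormedAddCommGroup E] [NormedSpace ℝ E] {J P R : E → Mat2} {p : E}

lemma contDiffAt_trace (hJ : ContDiffAt ℝ 1 J p) : ContDiffAt ℝ 1 (fun q => (J q).trace) p :=
  traceL.contDiff.contDiffAt.comp p hJ

lemma contDiffAt_adjugate (hJ : ContDiffAt ℝ 1 J p) :
    ContDiffAt ℝ 1 (fun q => (J q).adjugate) p := by
  simp only [adjugate_eq]
  exact ((contDiffAt_trace hJ).smul contDiffAt_const).sub hJ

lemma contDiffAt_perp (hJ : ContDiffAt ℝ 1 J p) (hR : ContDiffAt ℝ 1 R p) :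
    ContDiffAt ℝ 1 (fun q => perp (J q) (R q)) p :=
  hR.add (((contDiffAt_trace (hJ.mul hR)).div_const 2).smul hJ)

lemma contDiffAt_rot (hJ : ContDiffAt ℝ 1 J p) {s : E → ℝ} (hs : ContDiffAt ℝ 1 s p) :
    ContDiffAt ℝ 1 (fun q => rot (J q) (s q)) p :=
  ((Real.contDiff_cos.contDiffAt.comp p hs).smul contDiffAt_const).add
    ((Real.contDiff_sin.contDiffAt.comp p hs).smul hJ)

lemma contDiffAt_conjWord (hJ : ContDiffAt ℝ 1 J p) (hP : ContDiffAt ℝ 1 P p)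
    (hR : ContDiffAt ℝ 1 R p) {s : E → Fin 4 → ℝ} (hs : ContDiffAt ℝ 1 s p) (k l m n : ℕ) :
    ContDiffAt ℝ 1 (fun q => conjWord (rot (J q)) (rot (-(P q * J q * P q)))
      (rot (-(R q * J q * R q))) k l m n (s q)) p := by
  have h (i) : ContDiffAt ℝ 1 (fun q => s q i) p := contDiffAt_pi.1 hs i
  have hJ' {u : E → ℝ} (hu : ContDiffAt ℝ 1 u p) := contDiffAt_rot hJ hu
  have hP' {u : E → ℝ} (hu : ContDiffAt ℝ 1 u p) := contDiffAt_rot ((hP.mul hJ).mul hP).neg hu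
  have hR' {u : E → ℝ} (hu : ContDiffAt ℝ 1 u p) := contDiffAt_rot ((hR.mul hJ).mul hR).neg hu
  have h₁ := (((hJ' (h 0)).mul (hP' (h 0))).pow 3).mul (((hJ' (h 0).neg).mul (hP' (h 0).neg)).pow 3)
  have h₂ := (((hJ' (h 1)).mul (hR' (h 1))).pow 3).mul (((hJ' (h 1).neg).mul (hR' (h 1).neg)).pow 3)
  have h₃ := ((((hR' (h 2)).mul (hJ' (h 2))).pow m).mul (hJ' (h 3))).mul
    (((hJ' (h 2)).mul (hP' (h 2))).pow n)
  exact ((h₁.pow k).mul (h₂.pow l)).mul h₃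

end smoothness

/-- A determinant depending on two switches `k` and `l` with nonzero mixed coefficient does not
vanish for some position of the switches. -/
lemma exists_switch {d₁ d₂ e₁ e₂ a₁ a₂ b₁ b₂ p q r : ℝ} (hq : q ≠ 0) (hr : r ≠ 0)
    (h : a₁ * b₂ - a₂ * b₁ ≠ 0) :
    ∃ k l : ℕ, (d₁ + k * (a₁ * p) + l * (b₁ * q)) * (e₂ + k * (a₂ * r)) -
      (d₂ + k * (a₂ * p) + l * (b₂ * q)) * (e₁ + k * (a₁ * r)) ≠ 0 := by
  by_contra! H
  have h00 := H 0 0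
  have h10 := H 1 0
  have h01 := H 0 1
  have h11 := H 1 1
  push_cast at h00 h10 h01 h11
  apply mul_ne_zero (mul_ne_zero hq hr) h
  linear_combination h10 + h01 - h00 - h11

lemma exists_sin_sq_mul_sq {x : ℝ} (hx : x < -2) : ∃ s : ℝ, Real.sin s ^ 2 * x ^ 2 = 1 := by
  refine ⟨Real.arcsin x⁻¹, ?_⟩
  have hx0 : x ≠ 0 := by linarith
  have h : |x⁻¹| ≤ 1 := by
    rw [abs_inv]
    apply inv_le_one_of_one_le₀
    rw [abs_of_neg (by linarith)]; linarith
  rw [Real.sin_arcsin (abs_le.1 h).1 (abs_le.1 h).2, inv_pow, inv_mul_cancel₀ (pow_ne_zero 2 hx0)]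

lemma trace_bracket_mul_self (J R : Mat2) : ((J * R - R * J) * R).trace = 0 := by
  rw [sub_mul, Matrix.trace_sub, sub_eq_zero, mul_assoc R, Matrix.trace_mul_comm R]

lemma det_conjWord {J P R : Mat2} (hJ : IsHalfTurn J) (hP : IsHalfTurn P) (hR : IsHalfTurn R)
    (k l m n : ℕ) (s : Fin 4 → ℝ) :
    (conjWord (rot J) (rot (-(P * J * P))) (rot (-(R * J * R))) k l m n s).det = 1 := by
  simp [conjWord, relWord, moveWord, Matrix.det_mul, Matrix.det_pow, det_rot hJ,
    det_rot (hP.conj hJ), det_rot (hR.conj hJ)]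

/-- The conjugate of `P` by the word `conjWord` in the rotations about `J`, `PJP⁻¹`, `RJR⁻¹`. -/
noncomputable def conjMat (k l m n : ℕ) (J P R : Mat2) (s : Fin 4 → ℝ) : Mat2 :=
  conjWord (rot J) (rot (-(P * J * P))) (rot (-(R * J * R))) k l m n s * P *
    (conjWord (rot J) (rot (-(P * J * P))) (rot (-(R * J * R))) k l m n s).adjugate

lemma IsHalfTurn.conjMat {J P R : Mat2} (hJ : IsHalfTurn J) (hP : IsHalfTurn P)
    (hR : IsHalfTurn R) (k l m n : ℕ) (s : Fin 4 → ℝ) : IsHalfTurn (conjMat k l m n J P R s) :=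
  hP.conj_adjugate (det_conjWord hJ hP hR k l m n s)

lemma conjMat_eq (k l m n : ℕ) (J P R : Mat2) (s : Fin 4 → ℝ) :
    conjMat k l m n J P R s =
      (relWord (rot J) (rot (-(P * J * P))) (s 0) ^ k *
        relWord (rot J) (rot (-(R * J * R))) (s 1) ^ l) * conjMat 0 0 m n J P R s *
      (relWord (rot J) (rot (-(P * J * P))) (s 0) ^ k *
        relWord (rot J) (rot (-(R * J * R))) (s 1) ^ l).adjugate := by
  simp only [conjMat, conjWord, pow_zero, one_mul, Matrix.adjugate_mul_distrib, mul_assoc]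

lemma conjMat_zero (m n : ℕ) (J P R : Mat2) (s : Fin 4 → ℝ) :
    conjMat 0 0 m n J P R s =
      moveWord (rot J) (rot (-(P * J * P))) (rot (-(R * J * R))) m n (s 2) (s 3) * P *
      (moveWord (rot J) (rot (-(P * J * P))) (rot (-(R * J * R))) m n (s 2) (s 3)).adjugate := by
  simp only [conjMat, conjWord, pow_zero, one_mul]

lemma contDiffAt_conjMat {E : Type*} [NormedAddCommGroup E] [NormedSpace ℝ E] {J P R : E → Mat2}
    {p : E} (hJ : ContDiffAt ℝ 1 J p) (hP : ContDiffAt ℝ 1 P p)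
    (hR : ContDiffAt ℝ 1 R p) {s : E → Fin 4 → ℝ} (hs : ContDiffAt ℝ 1 s p) (k l m n : ℕ) :
    ContDiffAt ℝ 1 (fun q => conjMat k l m n (J q) (P q) (R q) (s q)) p :=
  ((contDiffAt_conjWord hJ hP hR hs k l m n).mul hP).mul
    (contDiffAt_adjugate (contDiffAt_conjWord hJ hP hR hs k l m n))

lemma hasDerivAt_traces {J P R : ℝ → Mat2} (hJd : ContDiffAt ℝ 1 J 0)
    (hPd : ContDiffAt ℝ 1 P 0) (hRd : ContDiffAt ℝ 1 R 0)
    (hJ : ∀ᶠ t in 𝓝 0, IsHalfTurn (J t)) (hP : ∀ᶠ t in 𝓝 0, IsHalfTurn (P t))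
    (hR : ∀ᶠ t in 𝓝 0, IsHalfTurn (R t)) {s : Fin 4 → ℝ}
    (hs₀ : Real.sin (s 0) ^ 2 * (J 0 * P 0).trace ^ 2 = 1)
    (hs₁ : Real.sin (s 1) ^ 2 * (J 0 * R 0).trace ^ 2 = 1) {m n : ℕ}
    (hM : conjMat 0 0 m n (J 0) (P 0) (R 0) s = R 0) : ∃ d e : ℝ, ∀ a b : ℝ,
      HasDerivAt (fun t => (J t * P t).trace) a 0 →
      HasDerivAt (fun t => (J t * R t).trace) b 0 → ∀ k l : ℕ,
      HasDerivAt (fun t : ℝ => (J t * conjMat k l m n (J t) (P t) (R t) s).trace -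
          (J t * R t).trace)
        (d + k * (a * (-4 / (J 0 * P 0).trace ^ 2 *
            (J 0 * ((J 0 * P 0 - P 0 * J 0) * R 0 - R 0 * (J 0 * P 0 - P 0 * J 0))).trace)) +
          l * (b * (-4 / (J 0 * R 0).trace ^ 2 * (8 - 2 * (J 0 * R 0).trace ^ 2)))) 0 ∧
      HasDerivAt (fun t : ℝ => ((J t * R t - R t * J t) *
          conjMat k l m n (J t) (P t) (R t) s).trace)
        (e + k * (a * (-4 / (J 0 * P 0).trace ^ 2 *
          (2 * (J 0 * R 0).trace * ((J 0 * P 0 - P 0 * J 0) * R 0).trace)))) 0 := by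
  have hJ0 := hJ.self_of_nhds
  have hP0 := hP.self_of_nhds
  have hR0 := hR.self_of_nhds
  have dJ := hJd.differentiableAt one_ne_zero
  have dP := hPd.differentiableAt one_ne_zero
  have dR := hRd.differentiableAt one_ne_zero
  obtain ⟨J', hJ'⟩ : ∃ J', HasDerivAt J J' 0 := ⟨_, dJ.hasDerivAt⟩
  obtain ⟨M', hM'⟩ : ∃ M', HasDerivAt (fun t => conjMat 0 0 m n (J t) (P t) (R t) s) M' 0 :=
    ⟨_, ((contDiffAt_conjMat hJd hPd hRd (contDiffAt_const (c := s)) 0 0 m n).differentiableAt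
      one_ne_zero).hasDerivAt⟩
  obtain ⟨S', hS'⟩ : ∃ S', HasDerivAt (fun t => J t * R t - R t * J t) S' 0 :=
    ⟨_, ((dJ.fun_mul dR).fun_sub (dR.fun_mul dJ)).hasDerivAt⟩
  obtain ⟨T', hT'⟩ : ∃ T', HasDerivAt (fun t => J t * R t) T' 0 := ⟨_, (dJ.fun_mul dR).hasDerivAt⟩
  refine ⟨(J' * R 0).trace + (J 0 * M').trace - T'.trace,
    (S' * R 0).trace + ((J 0 * R 0 - R 0 * J 0) * M').trace, fun a b ha hb k l => ?_⟩
  have key := hasDerivAt_conj_relWord dJ dP dR hJ hP hR hs₀ hs₁ ha hb hM' hM k l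
  have hval : conjMat k l m n (J 0) (P 0) (R 0) s = R 0 := by
    rw [conjMat_eq, hM, relWord_eq_one hJ0 hP0 hs₀, relWord_eq_one hJ0 hR0 hs₁]
    simp
  simp only [← conjMat_eq] at key
  have k₁ := (hasDerivAt_trace (hJ'.fun_mul key)).fun_sub (hasDerivAt_trace hT')
  have k₂ := hasDerivAt_trace (hS'.fun_mul key)
  constructor
  · refine k₁.congr_deriv ?_
    rw [hval]
    simp only [mul_add, mul_smul_comm, Matrix.trace_add, Matrix.trace_smul, smul_eq_mul]
    rw [trace_mul_bracket_self hJ0 hR0]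
    ring
  · refine k₂.congr_deriv ?_
    rw [hval, mul_add, mul_add, mul_smul_comm, mul_smul_comm]
    simp only [Matrix.trace_add, Matrix.trace_smul, smul_eq_mul]
    rw [trace_bracket_mul_bracket_self, trace_bracket_mul_bracket hJ0 hR0]
    ring

variable {E : Type*} [NormedAddCommGroup E] [NormedSpace ℝ E]

lemma exists_conjWord_eq [CompleteSpace E] {J P R : E → Mat2} {q₀ : E}
    (hJd : ContDiffAt ℝ 1 J q₀) (hPd : ContDiffAt ℝ 1 P q₀) (hRd : ContDiffAt ℝ 1 R q₀)
    (hJ : ∀ᶠ q in 𝓝 q₀, IsHalfTurn (J q)) (hP : ∀ᶠ q in 𝓝 q₀, IsHalfTurn (P q))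
    (hR : ∀ᶠ q in 𝓝 q₀, IsHalfTurn (R q))
    (hχ : (J q₀ * P q₀).trace < -2) (hχ' : (J q₀ * R q₀).trace < -2)
    (hΓ : ((J q₀ * P q₀ - P q₀ * J q₀) * R q₀).trace ≠ 0)
    {h₁ h₂ : E} {a₁ a₂ b₁ b₂ : ℝ}
    (ha₁ : HasDerivAt (fun t : ℝ => (J (q₀ + t • h₁) * P (q₀ + t • h₁)).trace) a₁ 0)
    (ha₂ : HasDerivAt (fun t : ℝ => (J (q₀ + t • h₂) * P (q₀ + t • h₂)).trace) a₂ 0)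
    (hb₁ : HasDerivAt (fun t : ℝ => (J (q₀ + t • h₁) * R (q₀ + t • h₁)).trace) b₁ 0)
    (hb₂ : HasDerivAt (fun t : ℝ => (J (q₀ + t • h₂) * R (q₀ + t • h₂)).trace) b₂ 0)
    (hab : a₁ * b₂ - a₂ * b₁ ≠ 0) :
    ∃ (k l m n : ℕ) (s₀ : Fin 4 → ℝ), ∀ V ∈ 𝓝 q₀, ∀ᶠ s in 𝓝 s₀, ∃ q ∈ V,
      conjMat k l m n (J q) (P q) (R q) s = R q := by
  have hJ0 := hJ.self_of_nhds
  have hP0 := hP.self_of_nhds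
  have hR0 := hR.self_of_nhds
  obtain ⟨m, n, s₂, s₃, hW⟩ := exists_moveWord hJ0 hP0 hR0 hχ hχ'
  obtain ⟨s₀, hs₀⟩ := exists_sin_sq_mul_sq hχ
  obtain ⟨s₁, hs₁⟩ := exists_sin_sq_mul_sq hχ'
  obtain ⟨σ, hσ₀, hσ₁, hσ₂, hσ₃⟩ : ∃ σ : Fin 4 → ℝ, σ 0 = s₀ ∧ σ 1 = s₁ ∧ σ 2 = s₂ ∧ σ 3 = s₃ :=
    ⟨![s₀, s₁, s₂, s₃], rfl, rfl, rfl, rfl⟩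
  have hM₀ : conjMat 0 0 m n (J q₀) (P q₀) (R q₀) σ = R q₀ := by
    rw [conjMat_zero, hσ₂, hσ₃, hW]
  have hM (k l : ℕ) : conjMat k l m n (J q₀) (P q₀) (R q₀) σ = R q₀ := by
    rw [conjMat_eq, hM₀, hσ₀, hσ₁, relWord_eq_one hJ0 hP0 hs₀, relWord_eq_one hJ0 hR0 hs₁]
    simp
  have hline (h : E) : HasDerivAt (fun t : ℝ => q₀ + t • h) h 0 := by
    simpa using ((hasDerivAt_id (0 : ℝ)).smul_const h).const_add q₀
  have hcont (h : E) : Tendsto (fun t : ℝ => q₀ + t • h) (𝓝 0) (𝓝 q₀) := by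
    simpa using (hline h).continuousAt.tendsto
  have hcd {X : E → Mat2} (hX : ContDiffAt ℝ 1 X q₀) (h : E) :
      ContDiffAt ℝ 1 (fun t : ℝ => X (q₀ + t • h)) 0 := by
    have h1 : ContDiffAt ℝ 1 X (q₀ + (0 : ℝ) • h) := by rwa [zero_smul, add_zero]
    exact ContDiffAt.comp (0 : ℝ) h1 (contDiffAt_const.add (contDiffAt_id.smul contDiffAt_const))
  have hcurve (h : E) := hasDerivAt_traces (s := σ) (m := m) (n := n) (hcd hJd h) (hcd hPd h)
    (hcd hRd h) ((hcont h).eventually hJ) ((hcont h).eventually hP) ((hcont h).eventually hR)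
  simp only [zero_smul, add_zero, hσ₀, hσ₁] at hcurve
  obtain ⟨d₁, e₁, H₁⟩ := hcurve h₁ hs₀ hs₁ hM₀
  obtain ⟨d₂, e₂, H₂⟩ := hcurve h₂ hs₀ hs₁ hM₀
  have hχ0 : (J q₀ * P q₀).trace ≠ 0 := by linarith
  have hχ0' : (J q₀ * R q₀).trace ≠ 0 := by linarith
  obtain ⟨k, l, hkl⟩ := exists_switch (d₁ := d₁) (d₂ := d₂) (e₁ := e₁) (e₂ := e₂)
    (p := -4 / (J q₀ * P q₀).trace ^ 2 *
      (J q₀ * ((J q₀ * P q₀ - P q₀ * J q₀) * R q₀ - R q₀ * (J q₀ * P q₀ - P q₀ * J q₀))).trace)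
    (q := -4 / (J q₀ * R q₀).trace ^ 2 * (8 - 2 * (J q₀ * R q₀).trace ^ 2))
    (r := -4 / (J q₀ * P q₀).trace ^ 2 *
      (2 * (J q₀ * R q₀).trace * ((J q₀ * P q₀ - P q₀ * J q₀) * R q₀).trace))
    (mul_ne_zero (div_ne_zero (by norm_num) (pow_ne_zero 2 hχ0')) (by nlinarith))
    (mul_ne_zero (div_ne_zero (by norm_num) (pow_ne_zero 2 hχ0))
      (mul_ne_zero (mul_ne_zero two_ne_zero hχ0') hΓ)) hab
  obtain ⟨H₁₁, H₁₂⟩ := H₁ a₁ b₁ ha₁ hb₁ k l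
  obtain ⟨H₂₁, H₂₂⟩ := H₂ a₂ b₂ ha₂ hb₂ k l
  set D₁ := d₁ + _ + _
  set D₂ := d₂ + _ + _
  set E₁ := e₁ + _
  set E₂ := e₂ + _
  have hfst {X : E → Mat2} (hX : ContDiffAt ℝ 1 X q₀) :
      ContDiffAt ℝ 1 (fun p : E × (Fin 4 → ℝ) => X p.1) (q₀, σ) :=
    ContDiffAt.comp (q₀, σ) hX contDiffAt_fst
  have hMd : ContDiffAt ℝ 1 (fun p : E × (Fin 4 → ℝ) =>
      conjMat k l m n (J p.1) (P p.1) (R p.1) p.2) (q₀, σ) :=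
    contDiffAt_conjMat (hfst hJd) (hfst hPd) (hfst hRd) contDiffAt_snd k l m n
  set F : E × (Fin 4 → ℝ) → ℝ × ℝ := fun p =>
    ((J p.1 * conjMat k l m n (J p.1) (P p.1) (R p.1) p.2).trace - (J p.1 * R p.1).trace,
      ((J p.1 * R p.1 - R p.1 * J p.1) * conjMat k l m n (J p.1) (P p.1) (R p.1) p.2).trace) with hF
  have hFd : ContDiffAt ℝ 1 F (q₀, σ) :=
    ((contDiffAt_trace ((hfst hJd).mul hMd)).sub
      (contDiffAt_trace ((hfst hJd).mul (hfst hRd)))).prodMk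
    (contDiffAt_trace ((((hfst hJd).mul (hfst hRd)).sub ((hfst hRd).mul (hfst hJd))).mul hMd))
  obtain ⟨L, hL⟩ : ∃ L, HasStrictFDerivAt F L (q₀, σ) := ⟨_, hFd.hasStrictFDerivAt one_ne_zero⟩
  have hLline (h : E) : HasDerivAt (fun t : ℝ => F (q₀ + t • h, σ)) (L (h, 0)) 0 := by
    have h1 : HasFDerivAt F L (q₀ + (0 : ℝ) • h, σ) := by
      rw [zero_smul, add_zero]; exact hL.hasFDerivAt
    exact HasFDerivAt.comp_hasDerivAt (0 : ℝ) h1 ((hline h).prodMk (hasDerivAt_const (0 : ℝ) σ))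
  have hL₁ : L (h₁, 0) = (D₁, E₁) := (hLline h₁).unique (H₁₁.prodMk H₁₂)
  have hL₂ : L (h₂, 0) = (D₂, E₂) := (hLline h₂).unique (H₂₁.prodMk H₂₂)
  have hsurj : (L.prod (ContinuousLinearMap.snd ℝ E (Fin 4 → ℝ))).range = ⊤ := by
    rw [LinearMap.range_eq_top]
    rintro ⟨⟨u, v⟩, s⟩
    set δ := D₁ * E₂ - D₂ * E₁
    set u' := u - (L (0, s)).1 with hu'
    set v' := v - (L (0, s)).2 with hv'
    refine ⟨(((u' * E₂ - v' * D₂) / δ) • h₁ + ((v' * D₁ - u' * E₁) / δ) • h₂, s), ?_⟩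
    have hsplit : (((u' * E₂ - v' * D₂) / δ) • h₁ + ((v' * D₁ - u' * E₁) / δ) • h₂, s) =
        ((u' * E₂ - v' * D₂) / δ) • (h₁, (0 : Fin 4 → ℝ)) +
          ((v' * D₁ - u' * E₁) / δ) • (h₂, (0 : Fin 4 → ℝ)) + (0, s) := by
      simp
    have hval : L (((u' * E₂ - v' * D₂) / δ) • h₁ + ((v' * D₁ - u' * E₁) / δ) • h₂, s) = (u, v) := by
      rw [hsplit, map_add, map_add, map_smul, map_smul, hL₁, hL₂]
      ext
      · simp only [Prod.fst_add, Prod.smul_fst, smul_eq_mul]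
        have : (u' * E₂ - v' * D₂) / δ * D₁ + (v' * D₁ - u' * E₁) / δ * D₂ = u' := by
          field_simp; ring
        rw [this, hu']; ring
      · simp only [Prod.snd_add, Prod.smul_snd, smul_eq_mul]
        have : (u' * E₂ - v' * D₂) / δ * E₁ + (v' * D₁ - u' * E₁) / δ * E₂ = v' := by
          field_simp; ring
        rw [this, hv']; ring
    exact Prod.ext hval rfl
  have hmap := (hL.prodMk hasStrictFDerivAt_snd).map_nhds_eq_of_surj hsurj
  refine ⟨k, l, m, n, σ, fun V hV => ?_⟩
  have hfstT : Tendsto (fun p : E × (Fin 4 → ℝ) => p.1) (𝓝 (q₀, σ)) (𝓝 q₀) :=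
    continuous_fst.tendsto _
  have hF0 : F (q₀, σ) = 0 := by
    simp only [hF, hM, sub_self, trace_bracket_mul_self]
    rfl
  have hlt : ∀ᶠ p : E × (Fin 4 → ℝ) in 𝓝 (q₀, σ), (J p.1 * R p.1).trace < -2 :=
    (contDiffAt_trace ((hfst hJd).mul (hfst hRd))).continuousAt.eventually_lt_const hχ'
  have hpos : ∀ᶠ p : E × (Fin 4 → ℝ) in 𝓝 (q₀, σ), 0 < (perp (J p.1)
      (conjMat k l m n (J p.1) (P p.1) (R p.1) p.2) * perp (J p.1) (R p.1)).trace := by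
    refine (contDiffAt_trace ((contDiffAt_perp (hfst hJd) hMd).mul
      (contDiffAt_perp (hfst hJd) (hfst hRd)))).continuousAt.eventually_const_lt ?_
    change 0 < (perp (J q₀) (conjMat k l m n (J q₀) (P q₀) (R q₀) σ) * perp (J q₀) (R q₀)).trace
    rw [hM, perp_mul_perp hJ0 hR0]
    simp only [Matrix.trace_smul, Matrix.trace_one, Fintype.card_fin, smul_eq_mul]
    push_cast
    nlinarith
  have hG : ∀ᶠ p : E × (Fin 4 → ℝ) in 𝓝 (q₀, σ), F p = 0 →
      p.1 ∈ V ∧ conjMat k l m n (J p.1) (P p.1) (R p.1) p.2 = R p.1 := by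
    filter_upwards [hfstT.eventually hV, hfstT.eventually hJ, hfstT.eventually hP,
      hfstT.eventually hR, hlt, hpos] with p hpV hpJ hpP hpR hplt hppos hpF
    refine ⟨hpV, eq_of_trace_eq hpJ hpR (hpJ.conjMat hpP hpR k l m n p.2) ?_ hplt ?_ hppos⟩
    · exact (sub_eq_zero.1 (congrArg Prod.fst hpF)).symm
    · exact congrArg Prod.snd hpF
  have hev : ∀ᶠ y in 𝓝 ((F (q₀, σ), σ) : (ℝ × ℝ) × (Fin 4 → ℝ)), ∃ p : E × (Fin 4 → ℝ),
      (F p, p.2) = y ∧ (F p = 0 →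
        p.1 ∈ V ∧ conjMat k l m n (J p.1) (P p.1) (R p.1) p.2 = R p.1) := by
    change _ ∈ 𝓝 _
    rw [← hmap, Filter.mem_map]
    filter_upwards [hG] with p hp using ⟨p, rfl, hp⟩
  rw [hF0] at hev
  have hs : Tendsto (fun s : Fin 4 → ℝ => ((0 : ℝ × ℝ), s)) (𝓝 σ) (𝓝 (0, σ)) :=
    (Continuous.prodMk_right (0 : ℝ × ℝ)).tendsto σ
  filter_upwards [hs.eventually hev] with s ⟨p, hps, hp⟩
  obtain ⟨hp0, rfl⟩ := Prod.ext_iff.1 hps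
  exact ⟨p.1, hp hp0⟩

end Mat2

section words

lemma map_conjWord {T G H : Type*} [Neg T] [Monoid G] [Monoid H] (f : G →* H) (E₀ E₁ E₂ : T → G)
    (k l m n : ℕ) (s : Fin 4 → T) :
    f (Mat2.conjWord E₀ E₁ E₂ k l m n s) =
      Mat2.conjWord (fun t => f (E₀ t)) (fun t => f (E₁ t)) (fun t => f (E₂ t)) k l m n s := by
  simp [Mat2.conjWord, Mat2.relWord, Mat2.moveWord]

lemma conjWord_congr {T T' G : Type*} [Neg T] [Neg T'] [Monoid G] {E₀ E₁ E₂ : T → G}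
    {D₀ D₁ D₂ : T' → G} {s : Fin 4 → T} {s' : Fin 4 → T'}
    (h₀ : ∀ i, E₀ (s i) = D₀ (s' i)) (h₁ : ∀ i, E₁ (s i) = D₁ (s' i))
    (h₂ : ∀ i, E₂ (s i) = D₂ (s' i)) (h₀' : ∀ i, E₀ (-s i) = D₀ (-s' i))
    (h₁' : ∀ i, E₁ (-s i) = D₁ (-s' i)) (h₂' : ∀ i, E₂ (-s i) = D₂ (-s' i)) (k l m n : ℕ) :
    Mat2.conjWord E₀ E₁ E₂ k l m n s = Mat2.conjWord D₀ D₁ D₂ k l m n s' := by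
  simp only [Mat2.conjWord, Mat2.relWord, Mat2.moveWord, h₀, h₁, h₂, h₀', h₁', h₂']

/-- The boundary word `Y⁻¹X⁻¹YX`. -/
def bdryWord : F2 := Yg⁻¹ * Xg⁻¹ * Yg * Xg

/-- The word in the boundary words which conjugates one half-turn to another. -/
def connWord (k l m n : ℕ) (ν : Fin 4 → ℤ) : F2 :=
  Mat2.conjWord (fun j : ℤ => bdryWord ^ j) (fun j : ℤ => sigYZ bdryWord ^ j)
    (fun j : ℤ => sigXY bdryWord ^ j) k l m n ν

/-- The palindrome attached to a word `g`. -/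
def palWord (g : F2) : F2 := Yg * sigYZ g * g⁻¹

@[simp] lemma sigXY_Xg : sigXY Xg = Xg⁻¹ := by simp [sigXY, Xg]
@[simp] lemma sigXY_Yg : sigXY Yg = Yg⁻¹ := by simp [sigXY, Yg]
@[simp] lemma sigYZ_Xg : sigYZ Xg = Yg⁻¹ * Xg⁻¹ * Yg := by simp [sigYZ, Xg]
@[simp] lemma sigYZ_Yg : sigYZ Yg = Yg⁻¹ := by simp [sigYZ, Yg]

lemma hom_ext {G : Type*} [Group G] {f g : F2 →* G} (hX : f Xg = g Xg) (hY : f Yg = g Yg) :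
    f = g := by
  ext b
  cases b
  · exact hY
  · exact hX

lemma sigXY_sigYZ (g : F2) : sigXY (sigYZ g) = Yg * g * Yg⁻¹ := by
  have : sigXY.comp sigYZ = (MulAut.conj Yg).toMonoidHom :=
    hom_ext (by simp) (by simp)
  exact DFunLike.congr_fun this g

lemma sigXY_eq (g : F2) : sigXY g = Yg * sigYZ g * Yg⁻¹ := by
  have : sigXY = (MulAut.conj Yg).toMonoidHom.comp sigYZ :=
    hom_ext (by simp [mul_assoc]) (by simp)
  exact DFunLike.congr_fun this g

lemma palindromic_palWord (g : F2) : Palindromic (palWord g) := by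
  left
  simp only [palWord, map_mul, map_inv, sigXY_sigYZ, sigXY_Yg]
  rw [sigXY_eq g]
  group

/-- The exponent sum in `Y`. -/
def expY : F2 →* Multiplicative ℤ :=
  FreeGroup.lift fun b => if b then 1 else Multiplicative.ofAdd 1

@[simp] lemma expY_Xg : expY Xg = 1 := by simp [expY, Xg]
@[simp] lemma expY_Yg : expY Yg = Multiplicative.ofAdd 1 := by simp [expY, Yg]

lemma expY_sigYZ (g : F2) : expY (sigYZ g) = (expY g)⁻¹ := by
  have : expY.comp sigYZ = expY⁻¹ := hom_ext (by simp) (by simp)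
  exact DFunLike.congr_fun this g

lemma expY_bdryWord : expY bdryWord = 1 := by simp [bdryWord]

lemma expY_connWord (k l m n : ℕ) (ν : Fin 4 → ℤ) : expY (connWord k l m n ν) = 1 := by
  rw [connWord, map_conjWord]
  simp [sigXY_eq, expY_sigYZ, expY_bdryWord, Mat2.conjWord, Mat2.relWord, Mat2.moveWord]

lemma expY_palWord {g : F2} (hg : expY g = 1) : expY (palWord g) = Multiplicative.ofAdd 1 := by
  simp [palWord, expY_sigYZ, hg]

lemma not_torsionType {u : F2} (hu : expY u = Multiplicative.ofAdd 1) : ¬ TorsionType u := by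
  rintro ⟨r, -, m, hm, hur⟩
  have hle : Subgroup.normalClosure {r ^ m} ≤
      ((zpowGroupHom (m : ℤ) : Multiplicative ℤ →* Multiplicative ℤ).range).comap expY := by
    refine Subgroup.normalClosure_le_normal ?_
    rintro _ rfl
    exact ⟨expY r, by simp⟩
  obtain ⟨y, hy⟩ := hle hur
  rw [hu] at hy
  have h : (m : ℤ) * Multiplicative.toAdd y = 1 := congrArg Multiplicative.toAdd hy
  have := Int.eq_one_or_neg_one_of_mul_eq_one h
  omega

end words

lemma exists_int_combination {ψ : ℝ} (hψ : Irrational (ψ / (2 * Real.pi))) {s₀ : Fin 4 → ℝ}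
    {Q : (Fin 4 → ℝ) → Prop} (hQ : ∀ᶠ s in nhds s₀, Q s) :
    ∃ ν μ : Fin 4 → ℤ, Q fun i => ν i * ψ + μ i * (2 * Real.pi) := by
  obtain ⟨ε, hε, hball⟩ := Metric.eventually_nhds_iff.1 hQ
  have hd := dense_addSubgroupClosure_pair_iff.2 hψ
  have h (i : Fin 4) : ∃ a b : ℤ, dist (a * ψ + b * (2 * Real.pi)) (s₀ i) < ε := by
    obtain ⟨y, hy, hyd⟩ := hd.exists_dist_lt (s₀ i) hε
    obtain ⟨a, b, rfl⟩ := AddSubgroup.mem_closure_pair.1 hy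
    exact ⟨a, b, by simpa [dist_comm] using hyd⟩
  choose ν μ h using h
  exact ⟨ν, μ, hball ((dist_pi_lt_iff hε).2 h)⟩

/-- The representation of a point, with values in matrices. -/
noncomputable def rhoM (ξ : ℝ × ℝ × ℝ) : F2 →* Mat2 where
  toFun u := (rho ξ u : Matrix (Fin 2) (Fin 2) ℝ)
  map_one' := by simp
  map_mul' := by simp

lemma rhoM_inv (ξ : ℝ × ℝ × ℝ) (u : F2) : rhoM ξ u⁻¹ = (rhoM ξ u).adjugate := by
  simp [rhoM]

lemma rhoM_Xg (x y z : ℝ) : rhoM (x, y, z) Xg = !![x, -1; 1, 0] := by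
  simp [rhoM, rho, ev, Xg, Amat]

lemma rhoM_Yg (x y z : ℝ) :
    rhoM (x, y, z) Yg = !![0, (zetaOf z)⁻¹; -zetaOf z, y] := by
  simp [rhoM, rho, ev, Yg, Bmat]

namespace Mat2

lemma IsHalfTurn.neg_mul_mul_mul {P : Mat2} (hP : IsHalfTurn P) (X Y : Mat2) :
    -(P * (X * Y) * P) = -(P * X * P) * -(P * Y * P) := by
  have : P * X * P * (P * Y * P) = P * X * (P * P) * (Y * P) := by simp only [mul_assoc]
  rw [neg_mul_neg, this, hP.mul_self]
  simp [mul_assoc]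

end Mat2

/-- An endomorphism of `F₂` which is implemented on the generators by conjugation with a half-turn
is implemented by it on all words. -/
lemma rhoM_comp_eq {ξ : ℝ × ℝ × ℝ} {P : Mat2} (hP : P.IsHalfTurn) {f : F2 →* F2}
    (hX : rhoM ξ (f Xg) = -(P * rhoM ξ Xg * P)) (hY : rhoM ξ (f Yg) = -(P * rhoM ξ Yg * P))
    (g : F2) : rhoM ξ (f g) = -(P * rhoM ξ g * P) := by
  let c : F2 →* Mat2 :=
    { toFun := fun g => -(P * rhoM ξ g * P)
      map_one' := by simp [hP.mul_self]
      map_mul' := fun a b => by rw [map_mul, hP.neg_mul_mul_mul] }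
  have : (rhoM ξ).comp f = c := by
    ext b : 1
    cases b
    · exact hY
    · exact hX
  exact DFunLike.congr_fun this g

lemma Mat2.rot_zpow {J : Mat2} (hJ : J.IsHalfTurn) {ξ : ℝ × ℝ × ℝ} {w : F2} {ψ : ℝ}
    (h : rhoM ξ w = Mat2.rot J ψ) (n : ℤ) (m : ℤ) :
    rhoM ξ (w ^ n) = Mat2.rot J (n * ψ + m * (2 * Real.pi)) := by
  have hnat (n : ℕ) : rhoM ξ (w ^ n) = Mat2.rot J (n * ψ) := by
    induction n with
    | zero => simp [Mat2.rot_zero]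
    | succ n ih =>
      rw [pow_succ, map_mul, ih, h, ← Mat2.rot_add hJ]
      push_cast
      ring_nf
  rw [Mat2.rot_add_int_mul_two_pi]
  obtain ⟨n, rfl | rfl⟩ := n.eq_nat_or_neg
  · simpa using hnat n
  · rw [zpow_neg, zpow_natCast, rhoM_inv, hnat, Mat2.adjugate_rot hJ]
    push_cast
    ring_nf

lemma rhoM_palWord {ξ : ℝ × ℝ × ℝ} {J P R : Mat2} (hJ : J.IsHalfTurn) (hP : P.IsHalfTurn)
    (hR : R.IsHalfTurn) (hPX : rhoM ξ (sigYZ Xg) = -(P * rhoM ξ Xg * P))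
    (hPY : rhoM ξ (sigYZ Yg) = -(P * rhoM ξ Yg * P))
    (hRX : rhoM ξ (sigXY Xg) = -(R * rhoM ξ Xg * R))
    (hRY : rhoM ξ (sigXY Yg) = -(R * rhoM ξ Yg * R)) (hB : rhoM ξ Yg = -(R * P)) {ψ : ℝ}
    (hψ : rhoM ξ bdryWord = Mat2.rot J ψ) {k l m n : ℕ} {ν μ : Fin 4 → ℤ}
    (h : Mat2.conjMat k l m n J P R (fun i => ν i * ψ + μ i * (2 * Real.pi)) = R) :
    rhoM ξ (palWord (connWord k l m n ν)) = 1 := by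
  have hconj {Q : Mat2} (hQ : Q.IsHalfTurn) (t : ℝ) :
      -(Q * Mat2.rot J t * Q) = Mat2.rot (-(Q * J * Q)) t := by
    simp only [Mat2.rot, mul_add, add_mul, mul_smul_comm, smul_mul_assoc, mul_one, hQ.mul_self]
    module
  have hψP : rhoM ξ (sigYZ bdryWord) = Mat2.rot (-(P * J * P)) ψ := by
    rw [rhoM_comp_eq hP hPX hPY, hψ, hconj hP]
  have hψR : rhoM ξ (sigXY bdryWord) = Mat2.rot (-(R * J * R)) ψ := by
    rw [rhoM_comp_eq hR hRX hRY, hψ, hconj hR]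
  have hneg (i : Fin 4) : -((ν i : ℝ) * ψ + μ i * (2 * Real.pi)) =
      ((-ν i : ℤ) : ℝ) * ψ + ((-μ i : ℤ) : ℝ) * (2 * Real.pi) := by push_cast; ring
  have hg : rhoM ξ (connWord k l m n ν) = Mat2.conjWord (Mat2.rot J) (Mat2.rot (-(P * J * P)))
      (Mat2.rot (-(R * J * R))) k l m n (fun i => ν i * ψ + μ i * (2 * Real.pi)) := by
    rw [connWord, map_conjWord]
    refine conjWord_congr (fun i => ?_) (fun i => ?_) (fun i => ?_) (fun i => ?_) (fun i => ?_)
      (fun i => ?_) k l m n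
    · exact Mat2.rot_zpow hJ hψ _ _
    · exact Mat2.rot_zpow (hP.conj hJ) hψP _ _
    · exact Mat2.rot_zpow (hR.conj hJ) hψR _ _
    · rw [hneg]; exact Mat2.rot_zpow hJ hψ _ _
    · rw [hneg]; exact Mat2.rot_zpow (hP.conj hJ) hψP _ _
    · rw [hneg]; exact Mat2.rot_zpow (hR.conj hJ) hψR _ _
  rw [Mat2.conjMat, ← hg] at h
  rw [palWord, map_mul, map_mul, rhoM_inv, rhoM_comp_eq hP hPX hPY, hB]
  calc -(R * P) * -(P * rhoM ξ (connWord k l m n ν) * P) * (rhoM ξ (connWord k l m n ν)).adjugate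
      = R * (P * P) * (rhoM ξ (connWord k l m n ν) * P *
        (rhoM ξ (connWord k l m n ν)).adjugate) := by simp only [neg_mul_neg, mul_assoc]
    _ = 1 := by rw [h, hP.mul_self]; simp [hR.mul_self]

namespace Mat2

/-- The half-turn inverting the images of `X` and `Y`, up to the factor `2 * c`. -/
def preR (x y ζ w : ℝ) : Mat2 := !![w - ζ, y - x * w; y - ζ * x, ζ - w]

/-- The half-turn inverting the images of `Y` and `Z`, up to the factor `2 * c`. -/
def preP (x y ζ w : ℝ) : Mat2 := !![x - ζ * y, w ^ 2 - 1 + y ^ 2 - x * y * w; 1 - ζ ^ 2, ζ * y - x]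

/-- The half-turn commuting with the image of the boundary word, up to the factor `2 * s * c`. -/
def preJ (c x y ζ w : ℝ) : Mat2 :=
  !![1 - ζ ^ 2 - 2 * c ^ 2, ζ * (y - x * w); ζ * (y - ζ * x), ζ ^ 2 + 2 * c ^ 2 - 1]

section geometry

variable {c x y ζ w : ℝ}

lemma det_preR (h : (y - x * w) * (y - ζ * x) = -(ζ - w) ^ 2 - 4 * c ^ 2) :
    (preR x y ζ w).det = 4 * c ^ 2 := by
  rw [preR, Matrix.det_fin_two_of]
  linear_combination -h

lemma det_preP (hw : ζ * w = 1) (h : (y - x * w) * (y - ζ * x) = -(ζ - w) ^ 2 - 4 * c ^ 2) :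
    (preP x y ζ w).det = 4 * c ^ 2 := by
  rw [preP, Matrix.det_fin_two_of]
  grind

lemma det_preJ (hw : ζ * w = 1) (h : (y - x * w) * (y - ζ * x) = -(ζ - w) ^ 2 - 4 * c ^ 2) :
    (preJ c x y ζ w).det = 4 * c ^ 2 * (1 - c ^ 2) := by
  rw [preJ, Matrix.det_fin_two_of]
  grind

lemma trace_preJ_mul_preP (hw : ζ * w = 1)
    (h : (y - x * w) * (y - ζ * x) = -(ζ - w) ^ 2 - 4 * c ^ 2) :
    (preJ c x y ζ w * preP x y ζ w).trace = -(4 * c ^ 2 * x) := by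
  simp [preJ, preP, Matrix.trace_fin_two]
  grind

lemma trace_preJ_mul_preR (hw : ζ * w = 1)
    (h : (y - x * w) * (y - ζ * x) = -(ζ - w) ^ 2 - 4 * c ^ 2) :
    (preJ c x y ζ w * preR x y ζ w).trace = -(4 * c ^ 2 * (ζ + w)) := by
  simp [preJ, preR, Matrix.trace_fin_two]
  grind

lemma trace_bracket_preR (hw : ζ * w = 1)
    (h : (y - x * w) * (y - ζ * x) = -(ζ - w) ^ 2 - 4 * c ^ 2) :
    ((preJ c x y ζ w * preP x y ζ w - preP x y ζ w * preJ c x y ζ w) * preR x y ζ w).trace =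
      16 * c ^ 4 * y := by
  simp [preJ, preR, preP, Matrix.trace_fin_two]
  grind

lemma preR_mul_preP (hw : ζ * w = 1)
    (h : (y - x * w) * (y - ζ * x) = -(ζ - w) ^ 2 - 4 * c ^ 2) :
    preR x y ζ w * preP x y ζ w = -(4 * c ^ 2) • !![0, w; -ζ, y] := by
  ext i j
  fin_cases i <;> fin_cases j <;> simp [preR, preP] <;> grind

lemma preR_conj_X (hw : ζ * w = 1)
    (h : (y - x * w) * (y - ζ * x) = -(ζ - w) ^ 2 - 4 * c ^ 2) :
    preR x y ζ w * !![x, -1; 1, 0] * preR x y ζ w = -(4 * c ^ 2) • !![0, 1; -1, x] := by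
  ext i j
  fin_cases i <;> fin_cases j <;> simp [preR] <;> grind

lemma preR_conj_Y (hw : ζ * w = 1)
    (h : (y - x * w) * (y - ζ * x) = -(ζ - w) ^ 2 - 4 * c ^ 2) :
    preR x y ζ w * !![0, w; -ζ, y] * preR x y ζ w = -(4 * c ^ 2) • !![y, -w; ζ, 0] := by
  ext i j
  fin_cases i <;> fin_cases j <;> simp [preR] <;> grind

lemma preP_conj_Y (hw : ζ * w = 1)
    (h : (y - x * w) * (y - ζ * x) = -(ζ - w) ^ 2 - 4 * c ^ 2) :
    preP x y ζ w * !![0, w; -ζ, y] * preP x y ζ w = -(4 * c ^ 2) • !![y, -w; ζ, 0] := by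
  ext i j
  fin_cases i <;> fin_cases j <;> simp [preP] <;> grind

lemma preP_conj_X (hw : ζ * w = 1)
    (h : (y - x * w) * (y - ζ * x) = -(ζ - w) ^ 2 - 4 * c ^ 2) :
    preP x y ζ w * !![x, -1; 1, 0] * preP x y ζ w =
      -(4 * c ^ 2) • (!![y, -w; ζ, 0] * !![0, 1; -1, x] * !![0, w; -ζ, y]) := by
  ext i j
  fin_cases i <;> fin_cases j <;> simp [preP] <;> grind

lemma boundary_eq (hw : ζ * w = 1)
    (h : (y - x * w) * (y - ζ * x) = -(ζ - w) ^ 2 - 4 * c ^ 2) :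
    (!![y, -w; ζ, 0] * !![0, 1; -1, x] * !![0, w; -ζ, y] * !![x, -1; 1, 0] : Mat2) =
      (1 - 2 * c ^ 2) • (1 : Mat2) + preJ c x y ζ w := by
  ext i j
  fin_cases i <;> fin_cases j <;> simp [preJ] <;> grind

end geometry

/-- The half-turn inverting the images of `X` and `Y`. -/
noncomputable def turnR (c x y ζ : ℝ) : Mat2 := (2 * c)⁻¹ • preR x y ζ ζ⁻¹

/-- The half-turn inverting the images of `Y` and `Z`. -/
noncomputable def turnP (c x y ζ : ℝ) : Mat2 := (2 * c)⁻¹ • preP x y ζ ζ⁻¹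

/-- The half-turn commuting with the image of the boundary word. -/
noncomputable def turnJ (c s x y ζ : ℝ) : Mat2 := (2 * s * c)⁻¹ • preJ c x y ζ ζ⁻¹

section turns

variable {c s x y ζ : ℝ} (hc : c ≠ 0) (hs : s ≠ 0) (hsc : s ^ 2 + c ^ 2 = 1) (hζ : ζ ≠ 0)
  (h : (y - x * ζ⁻¹) * (y - ζ * x) = -(ζ - ζ⁻¹) ^ 2 - 4 * c ^ 2)

include hc h in
lemma isHalfTurn_turnR : IsHalfTurn (turnR c x y ζ) where
  trace_eq := by simp [turnR, preR, Matrix.trace_fin_two]; ring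
  det_eq := by
    rw [turnR, Matrix.det_smul, det_preR h, Fintype.card_fin]
    field_simp
    norm_num

include hc hζ h in
lemma isHalfTurn_turnP : IsHalfTurn (turnP c x y ζ) where
  trace_eq := by simp [turnP, preP, Matrix.trace_fin_two]; ring
  det_eq := by
    rw [turnP, Matrix.det_smul, det_preP (mul_inv_cancel₀ hζ) h, Fintype.card_fin]
    field_simp
    norm_num

include hc hs hsc hζ h in
lemma isHalfTurn_turnJ : IsHalfTurn (turnJ c s x y ζ) where
  trace_eq := by simp [turnJ, preJ, Matrix.trace_fin_two]; ring
  det_eq := by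
    rw [turnJ, Matrix.det_smul, det_preJ (mul_inv_cancel₀ hζ) h, Fintype.card_fin,
      show 1 - c ^ 2 = s ^ 2 by linarith]
    field_simp
    norm_num

include hc hζ h in
lemma trace_turnJ_mul_turnP : (turnJ c s x y ζ * turnP c x y ζ).trace = -(x / s) := by
  rw [turnJ, turnP, smul_mul_smul_comm, Matrix.trace_smul,
    trace_preJ_mul_preP (mul_inv_cancel₀ hζ) h, smul_eq_mul]
  field_simp
  norm_num

include hc hζ h in
lemma trace_turnJ_mul_turnR : (turnJ c s x y ζ * turnR c x y ζ).trace = -((ζ + ζ⁻¹) / s) := by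
  rw [turnJ, turnR, smul_mul_smul_comm, Matrix.trace_smul,
    trace_preJ_mul_preR (mul_inv_cancel₀ hζ) h, smul_eq_mul]
  field_simp
  norm_num

include hc hs hζ h in
lemma trace_bracket_turnR (hy : y ≠ 0) : ((turnJ c s x y ζ * turnP c x y ζ -
    turnP c x y ζ * turnJ c s x y ζ) * turnR c x y ζ).trace ≠ 0 := by
  rw [turnJ, turnP, turnR, smul_mul_smul_comm, smul_mul_smul_comm, mul_comm (2 * c)⁻¹, ← smul_sub,
    smul_mul_smul_comm, Matrix.trace_smul, trace_bracket_preR (mul_inv_cancel₀ hζ) h, smul_eq_mul]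
  positivity

include hc hζ h in
lemma turnR_mul_turnP : !![0, ζ⁻¹; -ζ, y] = -(turnR c x y ζ * turnP c x y ζ) := by
  rw [turnR, turnP, smul_mul_smul_comm, preR_mul_preP (mul_inv_cancel₀ hζ) h, smul_smul, ← neg_smul]
  rw [show -((2 * c)⁻¹ * (2 * c)⁻¹ * -(4 * c ^ 2)) = 1 by field_simp; norm_num, one_smul]

lemma smul_conj {M X Y : Mat2} (hc : c ≠ 0) (hM : M * X * M = -(4 * c ^ 2) • Y) :
    Y = -(((2 * c)⁻¹ • M) * X * ((2 * c)⁻¹ • M)) := by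
  rw [smul_mul_assoc, smul_mul_smul_comm, hM, smul_smul, ← neg_smul,
    show -((2 * c)⁻¹ * (2 * c)⁻¹ * -(4 * c ^ 2)) = 1 by field_simp; norm_num, one_smul]

end turns

end Mat2

section chart

/-- The product of the two coordinates of the chart. -/
noncomputable def chartK (c ζ : ℝ) : ℝ := 1 + 4 * c ^ 2 / (ζ - ζ⁻¹) ^ 2

/-- The first coordinate of the chart of the Fricke–Klein space. -/
noncomputable def chartX (c : ℝ) (q : ℝ × ℝ) : ℝ := q.2 + chartK c q.1 / q.2

/-- The second coordinate of the chart of the Fricke–Klein space. -/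
noncomputable def chartY (c : ℝ) (q : ℝ × ℝ) : ℝ := q.2 * q.1 + chartK c q.1 / q.2 * q.1⁻¹

/-- A chart of the Fricke–Klein space. -/
noncomputable def chart (c : ℝ) (q : ℝ × ℝ) : ℝ × ℝ × ℝ := (chartX c q, chartY c q, q.1 + q.1⁻¹)

/-- The domain of the chart. -/
def chartDom : Set (ℝ × ℝ) := {q | 1 < q.1 ∧ 0 < q.2}

lemma isOpen_chartDom : IsOpen chartDom :=
  (isOpen_lt continuous_const continuous_fst).inter (isOpen_lt continuous_const continuous_snd)

variable {c : ℝ} {q : ℝ × ℝ}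

lemma sub_inv_pos {ζ : ℝ} (h : 1 < ζ) : 0 < ζ - ζ⁻¹ := by
  have := inv_lt_one_of_one_lt₀ h
  linarith

lemma zetaOf_add_inv_s13 {ζ : ℝ} (h : 1 < ζ) : zetaOf (ζ + ζ⁻¹) = ζ := by
  have h0 : ζ * ζ⁻¹ = 1 := mul_inv_cancel₀ (by linarith)
  have h1 := sub_inv_pos h
  have h2 : 2 < ζ + ζ⁻¹ := by nlinarith
  rw [zetaOf, if_pos h2, show (ζ + ζ⁻¹) ^ 2 - 4 = (ζ - ζ⁻¹) ^ 2 by linear_combination 4 * h0,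
    Real.sqrt_sq h1.le]
  ring

lemma chart_rel (hq : q ∈ chartDom) :
    (chartY c q - chartX c q * q.1⁻¹) * (chartY c q - q.1 * chartX c q) =
      -(q.1 - q.1⁻¹) ^ 2 - 4 * c ^ 2 := by
  obtain ⟨h1, h2⟩ := hq
  have h3 := (sub_inv_pos h1).ne'
  have h4 : chartK c q.1 / q.2 * q.2 * (q.1 - q.1⁻¹) ^ 2 = (q.1 - q.1⁻¹) ^ 2 + 4 * c ^ 2 := by
    rw [div_mul_cancel₀ _ h2.ne', chartK, add_mul, div_mul_cancel₀ _ (pow_ne_zero 2 h3), one_mul]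
  rw [chartX, chartY]
  linear_combination -h4

lemma chart_mem_FK {θ : ℝ} (hc : c ^ 2 ≠ 0) (hθ : Real.cos (θ / 2) = 2 * c ^ 2 - 1)
    (hq : q ∈ chartDom) : chart c q ∈ FK θ := by
  have hrel := chart_rel (c := c) hq
  obtain ⟨h1, h2⟩ := hq
  have h3 := sub_inv_pos h1
  have h0 : q.1 * q.1⁻¹ = 1 := mul_inv_cancel₀ (by linarith)
  have hK : 1 < chartK c q.1 := by
    rw [chartK]
    have : 0 < 4 * c ^ 2 / (q.1 - q.1⁻¹) ^ 2 := by positivity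
    linarith
  have hb : chartK c q.1 / q.2 * q.2 = chartK c q.1 := div_mul_cancel₀ _ h2.ne'
  have hb0 : 0 < chartK c q.1 / q.2 := by positivity
  have amgm {a b : ℝ} (ha : 0 < a) (hb : 0 < b) (hab : 1 < a * b) : 2 < a + b := by
    nlinarith [sq_nonneg (a - b)]
  refine ⟨amgm h2 hb0 (by linarith), amgm (by positivity) (by positivity) ?_,
    by change 2 < q.1 + q.1⁻¹; nlinarith, ?_⟩
  · rw [show q.2 * q.1 * (chartK c q.1 / q.2 * q.1⁻¹) =
      (chartK c q.1 / q.2 * q.2) * (q.1 * q.1⁻¹) by ring, hb, h0]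
    linarith
  · rw [hθ]
    change chartX c q ^ 2 + chartY c q ^ 2 + (q.1 + q.1⁻¹) ^ 2 -
      chartX c q * chartY c q * (q.1 + q.1⁻¹) - 2 = _
    linear_combination hrel + (4 - chartX c q ^ 2) * h0

lemma exists_chart_eq {θ : ℝ} (hc : c ^ 2 ≠ 0) (hθ : Real.cos (θ / 2) = 2 * c ^ 2 - 1)
    {ξ : ℝ × ℝ × ℝ} (hξ : ξ ∈ FK θ) : ∃ q ∈ chartDom, chart c q = ξ := by
  obtain ⟨x, y, z⟩ := ξ
  obtain ⟨hx, hy, hz, h⟩ := hξ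
  simp only at hx hy hz h
  obtain ⟨ζ, hζ, rfl⟩ : ∃ ζ, 1 < ζ ∧ ζ + ζ⁻¹ = z := by
    have h4 : 0 < z ^ 2 - 4 := by nlinarith
    have h5 := Real.sq_sqrt h4.le
    have h6 := Real.sqrt_pos.2 h4
    refine ⟨(z + √(z ^ 2 - 4)) / 2, by linarith, ?_⟩
    have : z + √(z ^ 2 - 4) ≠ 0 := by positivity
    field_simp
    linear_combination h5
  have h3 := sub_inv_pos hζ
  have h0 : ζ * ζ⁻¹ = 1 := mul_inv_cancel₀ (by linarith)
  have hw : 0 < ζ⁻¹ := by positivity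
  rw [hθ] at h
  set w := ζ⁻¹ with hwdef
  have hab : ((y - x * w) / (ζ - w)) * ((x * ζ - y) / (ζ - w)) = chartK c ζ := by
    rw [chartK, ← hwdef]
    field_simp
    linear_combination -h + (4 - x ^ 2) * h0
  have hsum : (y - x * w) / (ζ - w) + (x * ζ - y) / (ζ - w) = x := by
    field_simp; ring
  have hK : 1 < chartK c ζ := by
    rw [chartK, ← hwdef]
    have : 0 < 4 * c ^ 2 / (ζ - w) ^ 2 := by positivity
    linarith
  set a := (y - x * w) / (ζ - w) with ha
  set b := (x * ζ - y) / (ζ - w) with hb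
  have ha0 : 0 < a := by
    by_contra hcon
    nlinarith
  have hKa : chartK c ζ / a = b := by rw [← hab]; field_simp
  refine ⟨(ζ, a), ⟨hζ, ha0⟩, ?_⟩
  have hX : chartX c (ζ, a) = x := by rw [chartX]; simp only; rw [hKa, hsum]
  have hY : chartY c (ζ, a) = y := by
    rw [chartY]; simp only; rw [hKa, ← hwdef, ha, hb]; field_simp; ring
  rw [chart, hX, hY]

end chart

namespace Mat2

lemma contDiffAt_of {E : Type*} [NormedAddCommGroup E] [NormedSpace ℝ E] {a b c d : E → ℝ} {q : E}
    (ha : ContDiffAt ℝ 1 a q) (hb : ContDiffAt ℝ 1 b q) (hc : ContDiffAt ℝ 1 c q)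
    (hd : ContDiffAt ℝ 1 d q) :
    ContDiffAt ℝ 1 (fun p => (!![a p, b p; c p, d p] : Mat2)) q := by
  have h (p : E) : (!![a p, b p; c p, d p] : Mat2) =
      a p • (!![1, 0; 0, 0] : Mat2) + b p • (!![0, 1; 0, 0] : Mat2) +
        c p • (!![0, 0; 1, 0] : Mat2) + d p • (!![0, 0; 0, 1] : Mat2) := by
    ext i j
    fin_cases i <;> fin_cases j <;> simp
  simp_rw [h]
  exact (((ha.smul contDiffAt_const).add (hb.smul contDiffAt_const)).add
    (hc.smul contDiffAt_const)).add (hd.smul contDiffAt_const)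

end Mat2

section chartCurves

variable {c s : ℝ} {q : ℝ × ℝ}

lemma contDiffAt_inv_fst (hq : q ∈ chartDom) : ContDiffAt ℝ 1 (fun p : ℝ × ℝ => p.1⁻¹) q :=
  contDiffAt_fst.inv (by linarith [hq.1])

lemma contDiffAt_chartK_div (hq : q ∈ chartDom) :
    ContDiffAt ℝ 1 (fun p : ℝ × ℝ => chartK c p.1 / p.2) q := by
  have h1 := contDiffAt_inv_fst hq
  have h2 : ContDiffAt ℝ 1 (fun p : ℝ × ℝ => p.1) q := contDiffAt_fst
  unfold chartK
  exact (contDiffAt_const.add (contDiffAt_const.div ((h2.sub h1).pow 2)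
    (pow_ne_zero 2 (sub_inv_pos hq.1).ne'))).div contDiffAt_snd hq.2.ne'

lemma contDiffAt_chartX (hq : q ∈ chartDom) : ContDiffAt ℝ 1 (chartX c) q :=
  contDiffAt_snd.add (contDiffAt_chartK_div hq)

lemma contDiffAt_chartY (hq : q ∈ chartDom) : ContDiffAt ℝ 1 (chartY c) q :=
  (contDiffAt_snd.mul contDiffAt_fst).add ((contDiffAt_chartK_div hq).mul (contDiffAt_inv_fst hq))

lemma continuousAt_chart (hq : q ∈ chartDom) : ContinuousAt (chart c) q :=
  (contDiffAt_chartX hq).continuousAt.prodMk ((contDiffAt_chartY hq).continuousAt.prodMk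
    (continuousAt_fst.add (contDiffAt_inv_fst hq).continuousAt))

/-- The half-turn `Mat2.turnJ` along the chart. -/
noncomputable def chartJ (c s : ℝ) (q : ℝ × ℝ) : Mat2 :=
  Mat2.turnJ c s (chartX c q) (chartY c q) q.1

/-- The half-turn `Mat2.turnP` along the chart. -/
noncomputable def chartP (c : ℝ) (q : ℝ × ℝ) : Mat2 := Mat2.turnP c (chartX c q) (chartY c q) q.1

/-- The half-turn `Mat2.turnR` along the chart. -/
noncomputable def chartR (c : ℝ) (q : ℝ × ℝ) : Mat2 := Mat2.turnR c (chartX c q) (chartY c q) q.1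

lemma contDiffAt_chartJ (hq : q ∈ chartDom) : ContDiffAt ℝ 1 (chartJ c s) q := by
  have hx := contDiffAt_chartX (c := c) hq
  have hy := contDiffAt_chartY (c := c) hq
  have hw := contDiffAt_inv_fst hq
  have hf : ContDiffAt ℝ 1 (fun p : ℝ × ℝ => p.1) q := contDiffAt_fst
  unfold chartJ Mat2.turnJ Mat2.preJ
  refine ContDiffAt.const_smul _ (Mat2.contDiffAt_of ?_ ?_ ?_ ?_) <;> fun_prop

lemma contDiffAt_chartP (hq : q ∈ chartDom) : ContDiffAt ℝ 1 (chartP c) q := by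
  have hx := contDiffAt_chartX (c := c) hq
  have hy := contDiffAt_chartY (c := c) hq
  have hw := contDiffAt_inv_fst hq
  have hf : ContDiffAt ℝ 1 (fun p : ℝ × ℝ => p.1) q := contDiffAt_fst
  unfold chartP Mat2.turnP Mat2.preP
  refine ContDiffAt.const_smul _ (Mat2.contDiffAt_of ?_ ?_ ?_ ?_) <;> fun_prop

lemma contDiffAt_chartR (hq : q ∈ chartDom) : ContDiffAt ℝ 1 (chartR c) q := by
  have hx := contDiffAt_chartX (c := c) hq
  have hy := contDiffAt_chartY (c := c) hq
  have hw := contDiffAt_inv_fst hq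
  have hf : ContDiffAt ℝ 1 (fun p : ℝ × ℝ => p.1) q := contDiffAt_fst
  unfold chartR Mat2.turnR Mat2.preR
  refine ContDiffAt.const_smul _ (Mat2.contDiffAt_of ?_ ?_ ?_ ?_) <;> fun_prop

lemma fst_ne_zero_of_mem (hq : q ∈ chartDom) : q.1 ≠ 0 := by linarith [hq.1]

lemma isHalfTurn_chartJ (hc : c ≠ 0) (hs : s ≠ 0) (hsc : s ^ 2 + c ^ 2 = 1) (hq : q ∈ chartDom) :
    (chartJ c s q).IsHalfTurn :=
  Mat2.isHalfTurn_turnJ hc hs hsc (fst_ne_zero_of_mem hq) (chart_rel hq)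

lemma isHalfTurn_chartP (hc : c ≠ 0) (hq : q ∈ chartDom) : (chartP c q).IsHalfTurn :=
  Mat2.isHalfTurn_turnP hc (fst_ne_zero_of_mem hq) (chart_rel hq)

lemma isHalfTurn_chartR (hc : c ≠ 0) (hq : q ∈ chartDom) : (chartR c q).IsHalfTurn :=
  Mat2.isHalfTurn_turnR hc (chart_rel hq)

lemma trace_chartJ_mul_chartP (hc : c ≠ 0) (hq : q ∈ chartDom) :
    (chartJ c s q * chartP c q).trace = -(chartX c q / s) :=
  Mat2.trace_turnJ_mul_turnP hc (fst_ne_zero_of_mem hq) (chart_rel hq)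

lemma trace_chartJ_mul_chartR (hc : c ≠ 0) (hq : q ∈ chartDom) :
    (chartJ c s q * chartR c q).trace = -((q.1 + q.1⁻¹) / s) :=
  Mat2.trace_turnJ_mul_turnR hc (fst_ne_zero_of_mem hq) (chart_rel hq)

lemma hasDerivAt_comp_line {f g : ℝ × ℝ → ℝ} {h : ℝ × ℝ} {d : ℝ} (hq : q ∈ chartDom)
    (hfg : ∀ p ∈ chartDom, f p = g p) (hg : HasDerivAt (fun t : ℝ => g (q + t • h)) d 0) :
    HasDerivAt (fun t : ℝ => f (q + t • h)) d 0 := by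
  have hcont : ContinuousAt (fun t : ℝ => q + t • h) 0 := by fun_prop
  have hev : ∀ᶠ t in nhds (0 : ℝ), q + t • h ∈ chartDom :=
    hcont.eventually_mem (by simpa using isOpen_chartDom.mem_nhds hq)
  exact hg.congr_of_eventuallyEq (hev.mono fun t ht => hfg _ ht)

/-- Near a point of the chart where its first coordinate is not critical along the second axis,
the half-turns can be matched by a word, up to a small perturbation of the point. -/
lemma exists_chart_conjMat_eq (hc : c ≠ 0) (hs : 0 < s) (hsc : s ^ 2 + c ^ 2 = 1)
    (hq : q ∈ chartDom) (hx : 2 < chartX c q) (hy : chartY c q ≠ 0) (hcrit : q.2 ^ 2 ≠ chartK c q.1) :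
    ∃ (k l m n : ℕ) (s₀ : Fin 4 → ℝ), ∀ V ∈ nhds q, ∀ᶠ r in nhds s₀,
      ∃ p ∈ V, Mat2.conjMat k l m n (chartJ c s p) (chartP c p) (chartR c p) r = chartR c p := by
  have hmem : ∀ᶠ p in nhds q, p ∈ chartDom := isOpen_chartDom.mem_nhds hq
  have h0 := fst_ne_zero_of_mem hq
  have hs1 : s < 1 := by
    have : 0 < c ^ 2 := by positivity
    nlinarith
  have hlarge {x : ℝ} (hx : 2 < x) : -(x / s) < -2 := by
    rw [neg_lt_neg_iff, lt_div_iff₀ hs]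
    nlinarith
  have hz : 2 < q.1 + q.1⁻¹ := by
    have h1 := sub_inv_pos hq.1
    have h2 : q.1 * q.1⁻¹ = 1 := mul_inv_cancel₀ h0
    have h3 := hq.1
    nlinarith
  have hline (h : ℝ × ℝ) : HasDerivAt (fun t : ℝ => q + t • h) h 0 := by
    simpa using ((hasDerivAt_id (0 : ℝ)).smul_const h).const_add q
  have hX1 : DifferentiableAt ℝ (fun t : ℝ => -(chartX c (q + t • ((1, 0) : ℝ × ℝ)) / s)) 0 := by
    have : DifferentiableAt ℝ (chartX c) (q + (0 : ℝ) • ((1, 0) : ℝ × ℝ)) := by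
      simpa using (contDiffAt_chartX hq).differentiableAt one_ne_zero
    exact ((this.comp (0 : ℝ) (hline _).differentiableAt).div_const s).neg
  have hX2 : HasDerivAt (fun t : ℝ => -(chartX c (q + t • ((0, 1) : ℝ × ℝ)) / s))
      (-((1 - chartK c q.1 / q.2 ^ 2) / s)) 0 := by
    have h1 : HasDerivAt (fun t : ℝ => q.2 + t) 1 0 := (hasDerivAt_id (0 : ℝ)).const_add _
    have h2 := h1.add ((hasDerivAt_const (0 : ℝ) (chartK c q.1)).div h1 (by simpa using hq.2.ne'))
    refine ((h2.div_const s).neg.congr_deriv ?_).congr_of_eventuallyEq (.of_forall fun t => ?_)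
    · simp [sub_eq_add_neg, neg_div]
    · simp [chartX]
  have hZ1 : HasDerivAt (fun t : ℝ => -(((q + t • ((1, 0) : ℝ × ℝ)).1 +
      (q + t • ((1, 0) : ℝ × ℝ)).1⁻¹) / s)) (-((1 - 1 / q.1 ^ 2) / s)) 0 := by
    have h1 : HasDerivAt (fun t : ℝ => q.1 + t) 1 0 := (hasDerivAt_id (0 : ℝ)).const_add _
    refine (((h1.add (h1.inv (by simpa using h0))).div_const s).neg.congr_deriv
      ?_).congr_of_eventuallyEq (.of_forall fun t => ?_)
    · simp [sub_eq_add_neg, neg_div]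
    · simp
  have hZ2 : HasDerivAt (fun t : ℝ => -(((q + t • ((0, 1) : ℝ × ℝ)).1 +
      (q + t • ((0, 1) : ℝ × ℝ)).1⁻¹) / s)) 0 0 := by
    refine (hasDerivAt_const (0 : ℝ) (-((q.1 + q.1⁻¹) / s))).congr_of_eventuallyEq
      (.of_forall fun t => ?_)
    simp
  refine Mat2.exists_conjWord_eq (contDiffAt_chartJ hq) (contDiffAt_chartP hq)
    (contDiffAt_chartR hq) (hmem.mono fun p hp => isHalfTurn_chartJ hc hs.ne' hsc hp)
    (hmem.mono fun p hp => isHalfTurn_chartP hc hp)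
    (hmem.mono fun p hp => isHalfTurn_chartR hc hp)
    (by rw [trace_chartJ_mul_chartP hc hq]; exact hlarge hx)
    (by rw [trace_chartJ_mul_chartR hc hq]; exact hlarge hz)
    (Mat2.trace_bracket_turnR hc hs.ne' h0 (chart_rel hq) hy)
    (hasDerivAt_comp_line hq (f := fun p => (chartJ c s p * chartP c p).trace)
      (fun p hp => trace_chartJ_mul_chartP hc hp) hX1.hasDerivAt)
    (hasDerivAt_comp_line hq (f := fun p => (chartJ c s p * chartP c p).trace)
      (fun p hp => trace_chartJ_mul_chartP hc hp) hX2)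
    (hasDerivAt_comp_line hq (f := fun p => (chartJ c s p * chartR c p).trace)
      (fun p hp => trace_chartJ_mul_chartR hc hp) hZ1)
    (hasDerivAt_comp_line hq (f := fun p => (chartJ c s p * chartR c p).trace)
      (fun p hp => trace_chartJ_mul_chartR hc hp) hZ2) ?_
  have h1 : 1 - chartK c q.1 / q.2 ^ 2 ≠ 0 := by
    rw [sub_ne_zero, ne_comm, Ne, div_eq_one_iff_eq (pow_ne_zero 2 hq.2.ne')]
    exact hcrit.symm
  have h2 : 1 - 1 / q.1 ^ 2 ≠ 0 := by
    rw [sub_ne_zero, ne_comm, Ne, div_eq_one_iff_eq (pow_ne_zero 2 h0)]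
    nlinarith [hq.1]
  rw [mul_zero, zero_sub, neg_mul_neg, neg_ne_zero]
  exact mul_ne_zero (div_ne_zero h1 hs.ne') (div_ne_zero h2 hs.ne')

lemma rhoM_palWord_chart (hc : c ≠ 0) (hs : s ≠ 0) (hsc : s ^ 2 + c ^ 2 = 1) (hq : q ∈ chartDom)
    {ψ : ℝ} (hcos : Real.cos ψ = 1 - 2 * c ^ 2) (hsin : Real.sin ψ = 2 * s * c)
    {k l m n : ℕ} {ν μ : Fin 4 → ℤ}
    (h : Mat2.conjMat k l m n (chartJ c s q) (chartP c q) (chartR c q)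
      (fun i => ν i * ψ + μ i * (2 * Real.pi)) = chartR c q) :
    rhoM (chart c q) (palWord (connWord k l m n ν)) = 1 := by
  have hrel := chart_rel (c := c) hq
  have h0 := fst_ne_zero_of_mem hq
  have h1 : q.1 * q.1⁻¹ = 1 := mul_inv_cancel₀ h0
  have hX : rhoM (chart c q) Xg = !![chartX c q, -1; 1, 0] := rhoM_Xg _ _ _
  have hY : rhoM (chart c q) Yg = !![0, q.1⁻¹; -q.1, chartY c q] := by
    rw [chart, rhoM_Yg, zetaOf_add_inv_s13 hq.1]
  have hX' : rhoM (chart c q) Xg⁻¹ = !![0, 1; -1, chartX c q] := by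
    rw [rhoM_inv, hX, Matrix.adjugate_fin_two_of, neg_neg]
  have hY' : rhoM (chart c q) Yg⁻¹ = !![chartY c q, -q.1⁻¹; q.1, 0] := by
    rw [rhoM_inv, hY, Matrix.adjugate_fin_two_of, neg_neg]
  refine rhoM_palWord (isHalfTurn_chartJ hc hs hsc hq) (isHalfTurn_chartP hc hq)
    (isHalfTurn_chartR hc hq) ?_ ?_ ?_ ?_ ?_ ?_ h
  · rw [sigYZ_Xg, map_mul, map_mul, hX', hY', hX, hY]
    exact Mat2.smul_conj hc (Mat2.preP_conj_X h1 hrel)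
  · rw [sigYZ_Yg, hY', hY]
    exact Mat2.smul_conj hc (Mat2.preP_conj_Y h1 hrel)
  · rw [sigXY_Xg, hX', hX]
    exact Mat2.smul_conj hc (Mat2.preR_conj_X h1 hrel)
  · rw [sigXY_Yg, hY', hY]
    exact Mat2.smul_conj hc (Mat2.preR_conj_Y h1 hrel)
  · rw [hY]
    exact Mat2.turnR_mul_turnP hc h0 hrel
  · rw [bdryWord, map_mul, map_mul, map_mul, hX', hY', hX, hY, Mat2.boundary_eq h1 hrel, Mat2.rot,
      hcos, hsin, chartJ, Mat2.turnJ, smul_smul, mul_inv_cancel₀ (by positivity), one_smul]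

lemma exists_mem_snd_sq_ne {U : Set (ℝ × ℝ)} (hU : U ∈ nhds q) (K : ℝ → ℝ) (hq : 0 < q.2) :
    ∃ p ∈ U, p.2 ^ 2 ≠ K p.1 := by
  have h1 : ∀ᶠ a in nhdsWithin q.2 (Set.Ioi q.2), ((q.1, a) : ℝ × ℝ) ∈ U := by
    have : ContinuousAt (fun a : ℝ => ((q.1, a) : ℝ × ℝ)) q.2 := by fun_prop
    exact (this.eventually_mem hU).filter_mono nhdsWithin_le_nhds
  by_cases hK : q.2 ^ 2 = K q.1
  · obtain ⟨a, ha, haq⟩ := (h1.and self_mem_nhdsWithin).exists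
    refine ⟨(q.1, a), ha, ?_⟩
    rw [← hK]
    exact (pow_lt_pow_left₀ haq hq.le two_ne_zero).ne'
  · exact ⟨q, mem_of_mem_nhds hU, hK⟩

end chartCurves

/-- For `θ ∈ (0,2π)` with `θ/π` irrational, the set of `ξ ∈ 𝔠_θ` whose
holonomy kernel contains a palindromic non-torsion-type word is dense in `𝔠_θ`. -/
theorem stmt_13 (θ : ℝ) (hθ : θ ∈ Set.Ioo 0 (2 * Real.pi))
    (hirr : Irrational (θ / Real.pi)) :
    Dense {ξ : ↥(FK θ) | ∃ u : F2, Palindromic u ∧ ¬ TorsionType u ∧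
      ((rho ξ.1 u : Matrix (Fin 2) (Fin 2) ℝ) = 1 ∨
       (rho ξ.1 u : Matrix (Fin 2) (Fin 2) ℝ) = -1)} := by
  obtain ⟨hθ0, hθ2⟩ := hθ
  set c := Real.cos (θ / 4) with hcdef
  set s := Real.sin (θ / 4) with hsdef
  have hc : 0 < c := Real.cos_pos_of_mem_Ioo ⟨by linarith, by linarith⟩
  have hs : 0 < s := Real.sin_pos_of_pos_of_lt_pi (by linarith) (by linarith)
  have hsc : s ^ 2 + c ^ 2 = 1 := Real.sin_sq_add_cos_sq _
  have hcos : Real.cos (θ / 2) = 2 * c ^ 2 - 1 := by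
    rw [hcdef, ← Real.cos_two_mul]
    ring_nf
  have hcosψ : Real.cos (Real.pi - θ / 2) = 1 - 2 * c ^ 2 := by
    rw [Real.cos_pi_sub, hcos]
    ring
  have hsinψ : Real.sin (Real.pi - θ / 2) = 2 * s * c := by
    rw [Real.sin_pi_sub, hsdef, hcdef, ← Real.sin_two_mul]
    ring_nf
  have hψ : Irrational ((Real.pi - θ / 2) / (2 * Real.pi)) := by
    have h1 : (Real.pi - θ / 2) / (2 * Real.pi) = ((1 / 2 : ℚ) : ℝ) - θ / Real.pi / (4 : ℕ) := by
      push_cast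
      field_simp
      ring
    rw [h1]
    exact (hirr.div_natCast (by norm_num)).ratCast_sub _
  intro ξ
  rw [mem_closure_iff]
  intro U hU hξU
  obtain ⟨O, hO, rfl⟩ := isOpen_induced_iff.1 hU
  obtain ⟨q₀, hq₀, hq₀ξ⟩ := exists_chart_eq (by positivity) hcos ξ.2
  obtain ⟨q, ⟨hq, hqO⟩, hcrit⟩ := exists_mem_snd_sq_ne (Filter.inter_mem
    (isOpen_chartDom.mem_nhds hq₀) (continuousAt_chart (c := c) hq₀
      (hO.mem_nhds (by rw [hq₀ξ]; exact hξU)))) (chartK c) hq₀.2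
  have hmem := chart_mem_FK (by positivity) hcos hq
  obtain ⟨k, l, m, n, s₀, hs₀⟩ := exists_chart_conjMat_eq hc.ne' hs hsc hq hmem.1
    (by have : 2 < chartY c q := hmem.2.1
        linarith) hcrit
  obtain ⟨ν, μ, p, ⟨hp, hpO⟩, h⟩ := exists_int_combination hψ (hs₀ _ (Filter.inter_mem
    (isOpen_chartDom.mem_nhds hq) (continuousAt_chart (c := c) hq (hO.mem_nhds hqO))))
  exact ⟨⟨chart c p, chart_mem_FK (by positivity) hcos hp⟩, hpO, palWord (connWord k l m n ν),
    palindromic_palWord _, not_torsionType (expY_palWord (expY_connWord k l m n ν)),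
    Or.inl (rhoM_palWord_chart hc.ne' hs.ne' hsc hp hcosψ hsinψ h)⟩
end
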